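/- arXiv:1404.3617 — 2 statements merged into one kernel-verified Lean document; each statement's English description precedes it below -/
import Mathlib

section
/- Let 𝒫 be a set of prime numbers that is coinfinite in the set of all primes, and let E_𝒫 be the set of pairs (f, g) ∈ 𝒢 × 𝒢 such that f and g both code torsion-free 𝒫-divisible abelian groups and the groups coded by f and g are isomorphic. Then E_𝒫 is a complete analytic subset of ℕ^(ℕ×ℕ) × ℕ^(ℕ×ℕ): E_𝒫 is analytic, and for every analytic subset B of the Baire space ℕ^ℕ there exists a Borel function h : ℕ^ℕ → ℕ^(ℕ×ℕ) × ℕ^(ℕ×ℕ) with B = h⁻¹(E_𝒫). In particular, E_𝒫 is not Borel. -/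
open MeasureTheory

/-- `f : ℕ × ℕ → ℕ` codes a group structure on `ℕ` with multiplication
`a · b = f (a, b)`. -/
def IsGroupCode (f : ℕ × ℕ → ℕ) : Prop :=
  (∀ a b c, f (f (a, b), c) = f (a, f (b, c))) ∧
    ∃ e, (∀ a, f (e, a) = a ∧ f (a, e) = a) ∧ ∀ a, ∃ b, f (a, b) = e ∧ f (b, a) = e

/-- `e` is the identity element of the group coded by `f`. -/
def IsIdentityOf (f : ℕ × ℕ → ℕ) (e : ℕ) : Prop :=
  ∀ a, f (e, a) = a ∧ f (a, e) = a

/-- `codePow f x n` is the power `x^(n+1)` in the group coded by `f`. -/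
def codePow (f : ℕ × ℕ → ℕ) (x : ℕ) : ℕ → ℕ
  | 0 => x
  | n + 1 => f (x, codePow f x n)

/-- The group coded by `f` is torsion-free. -/
def IsTorsionFreeCode (f : ℕ × ℕ → ℕ) : Prop :=
  ∀ e, IsIdentityOf f e → ∀ x n, codePow f x n = e → x = e

/-- The group coded by `f` is `𝒫`-divisible: for each `r ∈ 𝒫` and each `x` there is `y`
with `y^r = x` (note `codePow f y (r-1) = y^r`). -/
def IsPDivisibleCode (P : Set ℕ) (f : ℕ × ℕ → ℕ) : Prop :=
  ∀ r ∈ P, ∀ x, ∃ y, codePow f y (r - 1) = x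

/-- `f` codes a torsion-free `𝒫`-divisible abelian group. -/
def IsTFPDivAbelianCode (P : Set ℕ) (f : ℕ × ℕ → ℕ) : Prop :=
  IsGroupCode f ∧ (∀ a b, f (a, b) = f (b, a)) ∧ IsTorsionFreeCode f ∧
    IsPDivisibleCode P f

/-- The relation `E_𝒫` of isomorphism of (codes of) torsion-free `𝒫`-divisible abelian
groups, as a subset of `ℕ^(ℕ×ℕ) × ℕ^(ℕ×ℕ)`. -/
def EP (P : Set ℕ) : Set ((ℕ × ℕ → ℕ) × (ℕ × ℕ → ℕ)) :=
  {x | IsTFPDivAbelianCode P x.1 ∧ IsTFPDivAbelianCode P x.2 ∧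
    ∃ θ : ℕ → ℕ, Function.Bijective θ ∧ ∀ a b, θ (x.1 (a, b)) = x.2 (θ a, θ b)}


/-! ### Analytic sets and trees -/

/-- Every analytic subset of Baire space is the projection of the branches of a tree on pairs. -/
theorem exists_tree_of_analyticSet {B : Set (ℕ → ℕ)} (hB : AnalyticSet B) :
    ∃ R : List ℕ → List ℕ → Prop, R [] [] ∧
      ∀ z, z ∈ B ↔ ∃ y : ℕ → ℕ, ∀ n, R (PiNat.res y n) (PiNat.res z n) := by
  rw [AnalyticSet] at hB
  rcases hB with rfl | ⟨g, hg, rfl⟩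
  · refine ⟨fun l _ => l = [], rfl, fun z => ⟨fun h => h.elim, ?_⟩⟩
    rintro ⟨y, hy⟩
    simpa using hy 1
  · refine ⟨fun l m => ∃ y, PiNat.res y l.length = l ∧ PiNat.res (g y) l.length = m,
      ⟨0, rfl, rfl⟩, fun z => ⟨?_, ?_⟩⟩
    · rintro ⟨y, rfl⟩
      exact ⟨y, fun n => ⟨y, by simp, by simp⟩⟩
    · rintro ⟨y, hy⟩
      simp only [PiNat.res_length] at hy
      choose w hw hgw using hy
      have h1 : Filter.Tendsto w Filter.atTop (nhds y) := by
        rw [tendsto_pi_nhds]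
        intro i
        refine tendsto_const_nhds.congr' ?_
        filter_upwards [Filter.eventually_gt_atTop i] with n hn
        exact (PiNat.res_eq_res.1 (hw n) hn).symm
      have h2 : Filter.Tendsto (fun n => g (w n)) Filter.atTop (nhds z) := by
        rw [tendsto_pi_nhds]
        intro i
        refine tendsto_const_nhds.congr' ?_
        filter_upwards [Filter.eventually_gt_atTop i] with n hn
        exact (PiNat.res_eq_res.1 (hgw n) hn).symm
      exact ⟨y, tendsto_nhds_unique ((hg.tendsto y).comp h1) h2⟩

theorem measurableSet_res_mem (n : ℕ) (S : Set (List ℕ)) :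
    MeasurableSet {x : ℕ → ℕ | PiNat.res x n ∈ S} := by
  have h : ∀ (n : ℕ) (l : List ℕ), MeasurableSet {x : ℕ → ℕ | PiNat.res x n = l} := by
    intro n
    induction n with
    | zero => intro l; simp
    | succ n ih =>
      rintro (_ | ⟨a, l⟩)
      · simp
      · simp only [PiNat.res_succ, List.cons.injEq]
        exact ((measurable_pi_apply n) (measurableSet_singleton a)).inter (ih l)
  have : {x : ℕ → ℕ | PiNat.res x n ∈ S} = ⋃ l ∈ S, {x : ℕ → ℕ | PiNat.res x n = l} := by
    ext x; simp
  rw [this]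
  exact MeasurableSet.biUnion (Set.to_countable S) fun l _ => h n l

/-- There is an analytic subset of Baire space which is not Borel. -/
theorem exists_analyticSet_not_measurableSet :
    ∃ B : Set (ℕ → ℕ), AnalyticSet B ∧ ¬ MeasurableSet B := by
  classical
  let c : List ℕ × List ℕ → ℕ := Encodable.encode
  have hc : Function.Injective c := Encodable.encode_injective
  let K : Set ((ℕ → ℕ) × (ℕ → ℕ)) :=
    {w | ∀ n, w.1 (c (PiNat.res w.2 n, PiNat.res w.1 n)) = 0}
  have hK : MeasurableSet K := by
    have : K = ⋂ n, ⋃ l, ⋃ m, {w | PiNat.res w.2 n = l} ∩ {w | PiNat.res w.1 n = m} ∩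
        {w | w.1 (c (l, m)) = 0} := by
      ext w; simp [K]
    rw [this]
    refine MeasurableSet.iInter fun n => MeasurableSet.iUnion fun l => MeasurableSet.iUnion fun m =>
      (MeasurableSet.inter ?_ ?_).inter ?_
    · exact measurable_snd (measurableSet_res_mem n {l})
    · exact measurable_fst (measurableSet_res_mem n {m})
    · exact ((measurable_pi_apply (c (l, m))).comp measurable_fst) (measurableSet_singleton 0)
  refine ⟨Prod.fst '' K, hK.analyticSet_image measurable_fst, fun hm => ?_⟩
  obtain ⟨R, -, hR⟩ := exists_tree_of_analyticSet hm.compl.analyticSet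
  let x : ℕ → ℕ := fun k => if ∃ l m, c (l, m) = k ∧ R l m then 0 else 1
  have hx : ∀ l m, x (c (l, m)) = 0 ↔ R l m := by
    intro l m
    simp only [x]
    constructor
    · intro h
      split_ifs at h with h'
      obtain ⟨l', m', he, h'⟩ := h'
      cases hc he
      exact h'
    · intro h
      rw [if_pos ⟨l, m, rfl, h⟩]
  have h1 : x ∈ Prod.fst '' K ↔ ∃ y : ℕ → ℕ, ∀ n, R (PiNat.res y n) (PiNat.res x n) := by
    simp only [← hx]
    constructor
    · rintro ⟨⟨_, y⟩, hy, rfl⟩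
      exact ⟨y, hy⟩
    · rintro ⟨y, hy⟩
      exact ⟨(x, y), hy, rfl⟩
  rw [← hR] at h1
  exact (iff_not_self h1)

/-! ### The isomorphism relation is analytic -/

theorem measurable_apply_of_countable {α ι : Type*} [MeasurableSpace α] [MeasurableSpace ι]
    [Countable ι] [MeasurableSingletonClass ι] {F : α → ι → ℕ} {i : α → ι}
    (hF : Measurable F) (hi : Measurable i) : Measurable fun a => F a (i a) := by
  have h : Measurable fun w : (ι → ℕ) × ι => w.1 w.2 :=
    measurable_from_prod_countable_left fun y => measurable_pi_apply y
  exact h.comp (hF.prodMk hi)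

theorem measurableSet_isTFPDivAbelianCode (P : Set ℕ) :
    MeasurableSet {f | IsTFPDivAbelianCode P f} := by
  have hev : ∀ {F G : (ℕ × ℕ → ℕ) → ℕ}, Measurable F → Measurable G →
      Measurable fun f : ℕ × ℕ → ℕ => f (F f, G f) := fun hF hG =>
    measurable_apply_of_countable measurable_id (hF.prodMk hG)
  have heq : ∀ {F G : (ℕ × ℕ → ℕ) → ℕ}, Measurable F → Measurable G →
      Measurable fun f => F f = G f := fun hF hG =>
    measurableSet_setOfPred.1 (measurableSet_eq_fun hF hG)
  have hpow : ∀ x n, Measurable fun f => codePow f x n := by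
    intro x n
    induction n with
    | zero => exact measurable_const
    | succ n ih => exact hev measurable_const ih
  have hc : ∀ n : ℕ, Measurable fun _ : ℕ × ℕ → ℕ => n := fun n => measurable_const
  have hid : ∀ e, Measurable fun f => IsIdentityOf f e := fun e =>
    Measurable.forall fun a => (heq (hev (hc e) (hc a)) (hc a)).and (heq (hev (hc a) (hc e)) (hc a))
  refine Measurable.setOf (Measurable.and (Measurable.and ?_ ?_) (Measurable.and ?_
    (Measurable.and ?_ ?_)))
  · exact Measurable.forall fun a => Measurable.forall fun b => Measurable.forall fun c =>
      heq (hev (hev (hc a) (hc b)) (hc c)) (hev (hc a) (hev (hc b) (hc c)))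
  · exact Measurable.exists fun e => (hid e).and (Measurable.forall fun a => Measurable.exists
      fun b => (heq (hev (hc a) (hc b)) (hc e)).and (heq (hev (hc b) (hc a)) (hc e)))
  · exact Measurable.forall fun a => Measurable.forall fun b =>
      heq (hev (hc a) (hc b)) (hev (hc b) (hc a))
  · exact Measurable.forall fun e => (hid e).imp (Measurable.forall fun x => Measurable.forall
      fun n => (heq (hpow x n) (hc e)).imp measurable_const)
  · exact Measurable.forall fun r => Measurable.forall fun _ => Measurable.forall fun x =>
      Measurable.exists fun y => heq (hpow y (r - 1)) (hc x)

theorem analyticSet_EP (P : Set ℕ) : AnalyticSet (EP P) := by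
  let K : Set (((ℕ × ℕ → ℕ) × (ℕ × ℕ → ℕ)) × (ℕ → ℕ)) :=
    {w | IsTFPDivAbelianCode P w.1.1 ∧ IsTFPDivAbelianCode P w.1.2 ∧
      ((∀ a b, w.2 a = w.2 b → a = b) ∧ ∀ b, ∃ a, w.2 a = b) ∧
      ∀ a b, w.2 (w.1.1 (a, b)) = w.1.2 (w.2 a, w.2 b)}
  have hK : MeasurableSet K := by
    have hθ : ∀ a, Measurable fun w : ((ℕ × ℕ → ℕ) × (ℕ × ℕ → ℕ)) × (ℕ → ℕ) => w.2 a :=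
      fun a => (measurable_pi_apply a).comp measurable_snd
    have heq : ∀ {F G : ((ℕ × ℕ → ℕ) × (ℕ × ℕ → ℕ)) × (ℕ → ℕ) → ℕ},
        Measurable F → Measurable G → Measurable fun w => F w = G w := fun hF hG =>
      measurableSet_setOfPred.1 (measurableSet_eq_fun hF hG)
    refine MeasurableSet.inter ?_ (MeasurableSet.inter ?_ (MeasurableSet.inter ?_ ?_))
    · exact (measurable_fst.comp measurable_fst) (measurableSet_isTFPDivAbelianCode P)
    · exact (measurable_snd.comp measurable_fst) (measurableSet_isTFPDivAbelianCode P)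
    · exact Measurable.setOf (Measurable.and
        (Measurable.forall fun a => Measurable.forall fun b =>
          (heq (hθ a) (hθ b)).imp measurable_const)
        (Measurable.forall fun b => Measurable.exists fun a => heq (hθ a) measurable_const))
    · refine Measurable.setOf (Measurable.forall fun a => Measurable.forall fun b => heq ?_ ?_)
      · exact measurable_apply_of_countable measurable_snd
          ((measurable_pi_apply (a, b)).comp (measurable_fst.comp measurable_fst))
      · exact measurable_apply_of_countable (measurable_snd.comp measurable_fst)
          ((hθ a).prodMk (hθ b))
  have : EP P = Prod.fst '' K := by
    ext x
    constructor
    · rintro ⟨h1, h2, θ, hθ, h⟩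
      exact ⟨(x, θ), ⟨h1, h2, ⟨fun a b hab => hθ.1 hab, hθ.2⟩, h⟩, rfl⟩
    · rintro ⟨⟨_, θ⟩, ⟨h1, h2, ⟨h3, h4⟩, h⟩, rfl⟩
      exact ⟨h1, h2, θ, ⟨fun a b hab => h3 a b hab, h4⟩, h⟩
  rw [this]
  exact hK.analyticSet_image measurable_fst

/-! ### Coding subgroups of a countable group -/

section SubgroupCode

variable {E : Type*} [AddCommGroup E]

open Classical in
/-- The code on `ℕ` of an infinite subgroup `G` of a group `E` enumerated by `e`. -/
noncomputable def subgroupCode (e : E ≃ ℕ) (G : AddSubgroup E) (z : ℕ × ℕ) : ℕ :=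
  Nat.count (fun m => e.symm m ∈ G)
    (e (e.symm (Nat.nth (fun m => e.symm m ∈ G) z.1) +
      e.symm (Nat.nth (fun m => e.symm m ∈ G) z.2)))

theorem infinite_setOf_symm_mem (e : E ≃ ℕ) (G : AddSubgroup E) [Infinite G] :
    {m | e.symm m ∈ G}.Infinite := by
  have h : (G : Set E).Infinite := Set.infinite_coe_iff.1 ‹_›
  have h2 := h.image e.injective.injOn
  rwa [e.image_eq_preimage_symm] at h2

theorem exists_equiv_subgroupCode (e : E ≃ ℕ) (G : AddSubgroup E) [Infinite G] :
    ∃ θ : ℕ ≃ G, ∀ a b, θ (subgroupCode e G (a, b)) = θ a + θ b := by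
  classical
  have hinf := infinite_setOf_symm_mem e G
  have hmem : ∀ a, e.symm (Nat.nth (fun m => e.symm m ∈ G) a) ∈ G :=
    fun a => Nat.nth_mem_of_infinite hinf a
  let θ : ℕ → G := fun a => ⟨_, hmem a⟩
  have hθ : Function.Bijective θ := by
    constructor
    · intro a b hab
      exact Nat.nth_injective hinf (e.symm.injective (congrArg Subtype.val hab))
    · rintro ⟨v, hv⟩
      refine ⟨Nat.count (fun m => e.symm m ∈ G) (e v), Subtype.ext ?_⟩
      change e.symm (Nat.nth _ (Nat.count _ _)) = v
      rw [Nat.nth_count (by simpa using hv)]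
      simp
  refine ⟨Equiv.ofBijective θ hθ, fun a b => Subtype.ext ?_⟩
  change e.symm (Nat.nth _ (Nat.count _ _)) = _
  rw [Nat.nth_count (by simpa using G.add_mem (hmem a) (hmem b))]
  simp [θ]

theorem measurable_subgroupCode {α : Type*} [MeasurableSpace α] (e : E ≃ ℕ)
    (G : α → AddSubgroup E) [∀ x, Infinite (G x)] (hG : ∀ v, MeasurableSet {x | v ∈ G x}) :
    Measurable fun x => subgroupCode e (G x) := by
  classical
  have hcount : ∀ m, Measurable fun x => Nat.count (fun k => e.symm k ∈ G x) m := by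
    intro m
    induction m with
    | zero => simp
    | succ m ih =>
      simp only [Nat.count_succ]
      exact ih.add (Measurable.ite (hG _) measurable_const measurable_const)
  have hnth : ∀ n, Measurable fun x => Nat.nth (fun k => e.symm k ∈ G x) n := by
    intro n
    refine measurable_to_countable' fun m => ?_
    have : (fun x => Nat.nth (fun k => e.symm k ∈ G x) n) ⁻¹' {m} =
        {x | e.symm m ∈ G x} ∩ {x | Nat.count (fun k => e.symm k ∈ G x) m = n} := by
      ext x
      have hinf := infinite_setOf_symm_mem e (G x)
      constructor
      · rintro rfl
        exact ⟨Nat.nth_mem_of_infinite hinf n, Nat.count_nth_of_infinite hinf n⟩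
      · rintro ⟨h1, h2⟩
        rw [Set.mem_preimage, Set.mem_singleton_iff, ← h2]
        exact Nat.nth_count h1
    rw [this]
    exact (hG _).inter (hcount m (measurableSet_singleton n))
  refine measurable_pi_lambda _ fun z => ?_
  have h : Measurable fun x => (fun k : ℕ => Nat.count (fun m => e.symm m ∈ G x) k) :=
    measurable_pi_lambda _ hcount
  refine measurable_apply_of_countable h (i := fun x =>
    e (e.symm (Nat.nth (fun m => e.symm m ∈ G x) z.1) +
      e.symm (Nat.nth (fun m => e.symm m ∈ G x) z.2))) ?_
  exact (measurable_of_countable (fun w : ℕ × ℕ => e (e.symm w.1 + e.symm w.2))).comp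
    ((hnth z.1).prodMk (hnth z.2))

end SubgroupCode

theorem codePow_eq_nsmul {A : Type*} [AddCommGroup A] {f : ℕ × ℕ → ℕ} (θ : ℕ ≃ A)
    (hθ : ∀ a b, θ (f (a, b)) = θ a + θ b) (x n : ℕ) : θ (codePow f x n) = (n + 1) • θ x := by
  induction n with
  | zero => simp [codePow]
  | succ n ih => rw [codePow, hθ, ih, add_comm, ← succ_nsmul]

theorem isTFPDivAbelianCode_of_equiv {P : Set ℕ} (hP : ∀ r ∈ P, Nat.Prime r)
    {A : Type*} [AddCommGroup A] [IsAddTorsionFree A]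
    (hA : ∀ r ∈ P, ∀ x : A, ∃ y, r • y = x) {f : ℕ × ℕ → ℕ} (θ : ℕ ≃ A)
    (hθ : ∀ a b, θ (f (a, b)) = θ a + θ b) : IsTFPDivAbelianCode P f := by
  refine ⟨⟨fun a b c => θ.injective ?_, θ.symm 0, fun a => ⟨θ.injective ?_, θ.injective ?_⟩,
    fun a => ⟨θ.symm (-θ a), θ.injective ?_, θ.injective ?_⟩⟩, fun a b => θ.injective ?_, ?_, ?_⟩
  · simp only [hθ, add_assoc]
  · simp [hθ]
  · simp [hθ]
  · simp [hθ]
  · simp [hθ]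
  · simp only [hθ, add_comm]
  · intro e he x n hx
    have h0 : θ e = 0 := by
      have := congrArg θ (he e).1
      simpa [hθ] using this
    have h1 := congrArg θ hx
    rw [codePow_eq_nsmul θ hθ, h0] at h1
    apply θ.injective
    rw [h0]
    exact (nsmul_eq_zero_iff_right (Nat.succ_ne_zero n)).1 h1
  · intro r hr x
    obtain ⟨y, hy⟩ := hA r hr (θ x)
    refine ⟨θ.symm y, θ.injective ?_⟩
    rw [codePow_eq_nsmul θ hθ, Nat.sub_add_cancel (hP r hr).one_le]
    simpa using hy

theorem mem_EP_iff_nonempty_addEquiv {P : Set ℕ} {A A' : Type*} [AddCommGroup A]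
    [AddCommGroup A'] {f f' : ℕ × ℕ → ℕ} (θ : ℕ ≃ A) (hθ : ∀ a b, θ (f (a, b)) = θ a + θ b)
    (θ' : ℕ ≃ A') (hθ' : ∀ a b, θ' (f' (a, b)) = θ' a + θ' b)
    (hf : IsTFPDivAbelianCode P f) (hf' : IsTFPDivAbelianCode P f') :
    (f, f') ∈ EP P ↔ Nonempty (A ≃+ A') := by
  constructor
  · rintro ⟨-, -, κ, hκ, h⟩
    refine ⟨⟨θ.symm.trans ((Equiv.ofBijective κ hκ).trans θ'), fun u v => ?_⟩⟩
    obtain ⟨a, rfl⟩ := θ.surjective u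
    obtain ⟨b, rfl⟩ := θ.surjective v
    rw [← hθ]
    simp [h, hθ']
  · rintro ⟨κ⟩
    refine ⟨hf, hf', θ.trans (κ.toEquiv.trans θ'.symm), Equiv.bijective _, fun a b => ?_⟩
    apply θ'.injective
    simp [hθ, hθ']

/-! ### Groups of forests -/

section ForestGroup

/-- Move every node at level `n + 1` to its parent. A node is a sequence, the most recent entry
first, together with the index of a tree. -/
def contractLevel (n : ℕ) (t : List ℕ × ℕ) : List ℕ × ℕ :=
  if t.1.length = n + 1 then (t.1.tail, t.2) else t

theorem padicNorm_mapDomain_le_one {α β : Type*} {p : ℕ} [Fact p.Prime] (a : α → β) (v : α →₀ ℚ)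
    (t : β) (h : ∀ s, a s = t → padicNorm p (v s) ≤ 1) :
    padicNorm p (v.mapDomain a t) ≤ 1 := by
  classical
  rw [Finsupp.mapDomain, Finsupp.sum_apply]
  refine padicNorm.sum_le' (fun s _ => ?_) zero_le_one
  dsimp only
  rw [Finsupp.single_apply]
  split_ifs with hs
  · exact h s hs
  · simp

theorem padicNorm_add_le_one {p : ℕ} [Fact p.Prime] {x y : ℚ} (hx : padicNorm p x ≤ 1)
    (hy : padicNorm p y ≤ 1) : padicNorm p (x + y) ≤ 1 :=
  padicNorm.nonarchimedean.trans (max_le hx hy)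

theorem eq_zero_of_forall_pow_mul {p : ℕ} [Fact p.Prime] {q : ℚ}
    (h : ∀ k : ℕ, ∃ c, padicNorm p c ≤ 1 ∧ (p : ℚ) ^ k * c = q) : q = 0 := by
  by_contra hq
  have hpos : 0 < padicNorm p q := (padicNorm.nonneg q).lt_of_ne' (padicNorm.nonzero hq)
  obtain ⟨k, hk⟩ := exists_pow_lt_of_lt_one hpos
    (padicNorm.padicNorm_p_lt_one (Fact.out : p.Prime).one_lt)
  obtain ⟨c, hc, rfl⟩ := h k
  rw [padicNorm.mul, IsAbsoluteValue.abv_pow (padicNorm p)] at hk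
  have := mul_le_of_le_one_right (pow_nonneg (padicNorm.nonneg (p := p) (p : ℚ)) k) hc
  linarith

variable (r : ℕ → ℕ) [∀ n, Fact (r n).Prime]

/-- The group of a forest `F`: the rational combinations of nodes of `F` which at the prime
`r (2 * n)` are integral outside level `n`, and at the prime `r (2 * n + 1)` become integral
when level `n + 1` is contracted to level `n`. -/
def forestGroup (F : Set (List ℕ × ℕ)) : AddSubgroup (List ℕ × ℕ →₀ ℚ) where
  carrier := {v | v ∈ Finsupp.supported ℚ ℚ F ∧
    (∀ n t, t.1.length ≠ n → padicNorm (r (2 * n)) (v t) ≤ 1) ∧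
    ∀ n t, padicNorm (r (2 * n + 1)) (v.mapDomain (contractLevel n) t) ≤ 1}
  zero_mem' := ⟨Submodule.zero_mem _, by simp, by simp⟩
  add_mem' := by
    rintro v w ⟨hv1, hv2, hv3⟩ ⟨hw1, hw2, hw3⟩
    refine ⟨Submodule.add_mem _ hv1 hw1, fun n t ht => ?_, fun n t => ?_⟩
    · exact padicNorm_add_le_one (hv2 n t ht) (hw2 n t ht)
    · rw [Finsupp.mapDomain_add]
      exact padicNorm_add_le_one (hv3 n t) (hw3 n t)
  neg_mem' := by
    rintro v ⟨hv1, hv2, hv3⟩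
    refine ⟨Submodule.neg_mem _ hv1, fun n t ht => ?_, fun n t => ?_⟩
    · rw [Finsupp.neg_apply, padicNorm.neg]
      exact hv2 n t ht
    · have : (-v).mapDomain (contractLevel n) = -v.mapDomain (contractLevel n) :=
        map_neg (Finsupp.mapDomain.addMonoidHom (contractLevel n)) v
      rw [this, Finsupp.neg_apply, padicNorm.neg]
      exact hv3 n t

variable {r} {F : Set (List ℕ × ℕ)}

theorem mem_forestGroup {v : List ℕ × ℕ →₀ ℚ} : v ∈ forestGroup r F ↔
    v ∈ Finsupp.supported ℚ ℚ F ∧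
    (∀ n t, t.1.length ≠ n → padicNorm (r (2 * n)) (v t) ≤ 1) ∧
    ∀ n t, padicNorm (r (2 * n + 1)) (v.mapDomain (contractLevel n) t) ≤ 1 :=
  Iff.rfl

theorem smul_mem_forestGroup {c : ℚ} (hc : ∀ n, padicNorm (r n) c ≤ 1)
    {v : List ℕ × ℕ →₀ ℚ} (hv : v ∈ forestGroup r F) : c • v ∈ forestGroup r F := by
  obtain ⟨hv1, hv2, hv3⟩ := hv
  refine ⟨Submodule.smul_mem _ c hv1, fun n t ht => ?_, fun n t => ?_⟩
  · rw [Finsupp.smul_apply, smul_eq_mul, padicNorm.mul]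
    exact mul_le_one₀ (hc _) (padicNorm.nonneg _) (hv2 n t ht)
  · rw [Finsupp.mapDomain_smul, Finsupp.smul_apply, smul_eq_mul, padicNorm.mul]
    exact mul_le_one₀ (hc _) (padicNorm.nonneg _) (hv3 n t)

theorem padicNorm_inv_pow_le_one {p q : ℕ} [Fact p.Prime] [Fact q.Prime] (h : p ≠ q) (k : ℕ) :
    padicNorm p ((q : ℚ) ^ k)⁻¹ ≤ 1 := by
  rw [IsAbsoluteValue.abv_inv (padicNorm p), IsAbsoluteValue.abv_pow (padicNorm p)]
  simp [padicNorm.padicNorm_of_prime_of_ne h]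

theorem forestGroup_divisible {q : ℕ} (hq : q.Prime) (hqr : ∀ n, r n ≠ q)
    (x : forestGroup r F) : ∃ y, q • y = x := by
  have : Fact q.Prime := ⟨hq⟩
  refine ⟨⟨((q : ℚ) ^ 1)⁻¹ • x.1,
    smul_mem_forestGroup (fun n => padicNorm_inv_pow_le_one (hqr n) 1) x.2⟩, Subtype.ext ?_⟩
  have hq0 : (q : ℚ) ≠ 0 := Nat.cast_ne_zero.2 hq.ne_zero
  ext t
  simp [hq0]

theorem single_mem_forestGroup {t : List ℕ × ℕ} (ht : t ∈ F) {c : ℚ}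
    (hc : ∀ n, n ≠ 2 * t.1.length → padicNorm (r n) c ≤ 1) :
    Finsupp.single t c ∈ forestGroup r F := by
  classical
  refine ⟨Finsupp.single_mem_supported ℚ c ht, fun n s hs => ?_, fun n s => ?_⟩
  · rw [Finsupp.single_apply]
    split_ifs with h
    · subst h
      exact hc _ (by omega)
    · simp
  · rw [Finsupp.mapDomain_single, Finsupp.single_apply]
    split_ifs with h
    · exact hc _ (by omega)
    · simp

theorem single_sub_single_mem_forestGroup {n : ℕ} {s t : List ℕ × ℕ} (hs : s ∈ F) (ht : t ∈ F)
    (hst : contractLevel n s = contractLevel n t) {c : ℚ}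
    (hc : ∀ m, m ≠ 2 * n + 1 → padicNorm (r m) c ≤ 1) :
    Finsupp.single s c - Finsupp.single t c ∈ forestGroup r F := by
  classical
  refine ⟨Submodule.sub_mem _ (Finsupp.single_mem_supported ℚ c hs)
    (Finsupp.single_mem_supported ℚ c ht), fun m u _ => ?_, fun m u => ?_⟩
  · rw [Finsupp.sub_apply, sub_eq_add_neg]
    refine padicNorm_add_le_one ?_ ?_
    · rw [Finsupp.single_apply]
      split_ifs
      · exact hc _ (by omega)
      · simp
    · rw [padicNorm.neg, Finsupp.single_apply]
      split_ifs
      · exact hc _ (by omega)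
      · simp
  · have : (Finsupp.single s c - Finsupp.single t c).mapDomain (contractLevel m) =
        Finsupp.single (contractLevel m s) c - Finsupp.single (contractLevel m t) c := by
      rw [← Finsupp.mapDomain_single, ← Finsupp.mapDomain_single]
      exact map_sub (Finsupp.mapDomain.addMonoidHom (contractLevel m)) _ _
    rw [this]
    by_cases hm : m = n
    · subst hm
      simp [hst]
    · rw [Finsupp.sub_apply, sub_eq_add_neg]
      refine padicNorm_add_le_one ?_ ?_
      · rw [Finsupp.single_apply]
        split_ifs
        · exact hc _ (by omega)
        · simp
      · rw [padicNorm.neg, Finsupp.single_apply]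
        split_ifs
        · exact hc _ (by omega)
        · simp

theorem apply_eq_zero_of_divisible {n : ℕ} {x : forestGroup r F}
    (hx : ∀ k : ℕ, ∃ y : forestGroup r F, r (2 * n) ^ k • y = x) {t : List ℕ × ℕ}
    (ht : t.1.length ≠ n) : x.1 t = 0 := by
  refine eq_zero_of_forall_pow_mul (p := r (2 * n)) fun k => ?_
  obtain ⟨y, rfl⟩ := hx k
  exact ⟨y.1 t, y.2.2.1 n t ht, by simp⟩

theorem mapDomain_contractLevel_eq_zero_of_divisible {n : ℕ} {x : forestGroup r F}
    (hx : ∀ k : ℕ, ∃ y : forestGroup r F, r (2 * n + 1) ^ k • y = x) :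
    x.1.mapDomain (contractLevel n) = 0 := by
  ext t
  refine eq_zero_of_forall_pow_mul (p := r (2 * n + 1)) fun k => ?_
  obtain ⟨y, rfl⟩ := hx k
  refine ⟨_, y.2.2.2 n t, ?_⟩
  have : (r (2 * n + 1) ^ k • y.1).mapDomain (contractLevel n) =
      r (2 * n + 1) ^ k • y.1.mapDomain (contractLevel n) :=
    map_nsmul (Finsupp.mapDomain.addMonoidHom (contractLevel n)) _ _
  simp [this]

theorem mapDomain_mem_forestGroup {a : List ℕ × ℕ → List ℕ × ℕ}
    (ha : ∀ t, (a t).1.length = t.1.length)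
    (hac : ∀ n t, contractLevel n (a t) = a (contractLevel n t))
    {v : List ℕ × ℕ →₀ ℚ} (hv : v ∈ forestGroup r Set.univ) :
    v.mapDomain a ∈ forestGroup r Set.univ := by
  obtain ⟨-, hv2, hv3⟩ := hv
  refine ⟨by simp, fun n t ht => ?_, fun n t => ?_⟩
  · refine padicNorm_mapDomain_le_one _ _ _ fun s hs => hv2 n s ?_
    rwa [← ha s, hs]
  · rw [← Finsupp.mapDomain_comp, show contractLevel n ∘ a = a ∘ contractLevel n from
      funext (hac n), Finsupp.mapDomain_comp]
    exact padicNorm_mapDomain_le_one _ _ _ fun s _ => hv3 n s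

theorem infinite_forestGroup {t : List ℕ × ℕ} (ht : t ∈ F) : Infinite (forestGroup r F) := by
  refine Infinite.of_injective (fun n : ℕ => (⟨Finsupp.single t (n : ℚ),
    single_mem_forestGroup ht fun m _ => ?_⟩ : forestGroup r F)) fun m n h => ?_
  · exact_mod_cast padicNorm.of_nat (p := r m) n
  · simpa using (Finsupp.single_injective t) (congrArg Subtype.val h)

theorem measurableSet_mem_forestGroup {α : Type*} [MeasurableSpace α]
    {F : α → Set (List ℕ × ℕ)} (hF : ∀ t, MeasurableSet {x | t ∈ F x})
    (v : List ℕ × ℕ →₀ ℚ) : MeasurableSet {x | v ∈ forestGroup r (F x)} := by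
  have h : {x | v ∈ Finsupp.supported ℚ ℚ (F x)} = ⋂ t ∈ v.support, {x | t ∈ F x} := by
    ext x
    simp [Finsupp.mem_supported, Set.subset_def]
  have h' : MeasurableSet {x | v ∈ Finsupp.supported ℚ ℚ (F x)} := by
    rw [h]
    exact MeasurableSet.biInter (Set.to_countable _) fun t _ => hF t
  exact Measurable.setOf ((measurableSet_setOfPred.1 h').and measurable_const)

end ForestGroup

/-! ### Splitting off a branch -/

section Branch

/-- Replace a node of the `i`-th tree by the node of the same level on the branch `b (σ i)` of the
`σ i`-th tree. -/
def toBranch (b : ℕ → ℕ → ℕ) (σ : ℕ → ℕ) (t : List ℕ × ℕ) : List ℕ × ℕ :=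
  (PiNat.res (b (σ t.2)) t.1.length, σ t.2)

theorem contractLevel_toBranch (b : ℕ → ℕ → ℕ) (σ : ℕ → ℕ) (n : ℕ) (t : List ℕ × ℕ) :
    contractLevel n (toBranch b σ t) = toBranch b σ (contractLevel n t) := by
  by_cases h : t.1.length = n + 1 <;> simp [contractLevel, toBranch, h]

theorem toBranch_toBranch (b : ℕ → ℕ → ℕ) (σ τ : ℕ → ℕ) (t : List ℕ × ℕ) :
    toBranch b σ (toBranch b τ t) = toBranch b (σ ∘ τ) t := by
  simp [toBranch]

/-- The linear map shifting the projections to the branches `b i` along `σ`. -/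
noncomputable def branchShift (b : ℕ → ℕ → ℕ) (σ : ℕ → ℕ) :
    (List ℕ × ℕ →₀ ℚ) →ₗ[ℚ] (List ℕ × ℕ →₀ ℚ) :=
  LinearMap.id - Finsupp.lmapDomain ℚ ℚ (toBranch b id) + Finsupp.lmapDomain ℚ ℚ (toBranch b σ)

theorem branchShift_single (b : ℕ → ℕ → ℕ) (σ : ℕ → ℕ) (t : List ℕ × ℕ) (c : ℚ) :
    branchShift b σ (Finsupp.single t c) = Finsupp.single t c - Finsupp.single (toBranch b id t) c +
      Finsupp.single (toBranch b σ t) c := by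
  simp [branchShift]

theorem branchShift_branchShift_single {b : ℕ → ℕ → ℕ} {σ τ : ℕ → ℕ} {t : List ℕ × ℕ}
    (h : σ (τ t.2) = t.2) (c : ℚ) :
    branchShift b σ (branchShift b τ (Finsupp.single t c)) = Finsupp.single t c := by
  have h' : toBranch b (σ ∘ τ) t = toBranch b id t := by simp [toBranch, h]
  simp only [branchShift_single, map_add, map_sub, toBranch_toBranch, Function.id_comp,
    Function.comp_id, h']
  abel

variable {r : ℕ → ℕ} [∀ n, Fact (r n).Prime] {F F' : Set (List ℕ × ℕ)}

theorem mem_forestGroup_iff_mem_univ {v : List ℕ × ℕ →₀ ℚ} :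
    v ∈ forestGroup r F ↔ v ∈ forestGroup r Set.univ ∧ v ∈ Finsupp.supported ℚ ℚ F := by
  simp only [mem_forestGroup, Finsupp.supported_univ, Submodule.mem_top, true_and]
  tauto

theorem branchShift_mem_forestGroup {b : ℕ → ℕ → ℕ} {σ : ℕ → ℕ}
    (h : ∀ t ∈ F, branchShift b σ (Finsupp.single t 1) ∈ Finsupp.supported ℚ ℚ F')
    {v : List ℕ × ℕ →₀ ℚ} (hv : v ∈ forestGroup r F) : branchShift b σ v ∈ forestGroup r F' := by
  rw [mem_forestGroup_iff_mem_univ] at hv ⊢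
  constructor
  · refine add_mem (sub_mem hv.1 ?_) ?_ <;>
    exact mapDomain_mem_forestGroup (fun t => by simp [toBranch])
      (fun n t => contractLevel_toBranch b _ n t) hv.1
  · have : Finsupp.supported ℚ ℚ F ≤
        (Finsupp.supported ℚ ℚ F').comap (branchShift b σ) := by
      rw [Finsupp.supported_eq_span_single, Submodule.span_le]
      rintro _ ⟨t, ht, rfl⟩
      exact h t ht
    exact this hv.2

theorem branchShift_branchShift {b : ℕ → ℕ → ℕ} {σ τ : ℕ → ℕ} (h : ∀ t ∈ F, σ (τ t.2) = t.2)
    {v : List ℕ × ℕ →₀ ℚ} (hv : v ∈ forestGroup r F) :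
    branchShift b σ (branchShift b τ v) = v := by
  have : Finsupp.supported ℚ ℚ F ≤
      LinearMap.eqLocus (branchShift b σ ∘ₗ branchShift b τ) LinearMap.id := by
    rw [Finsupp.supported_eq_span_single, Submodule.span_le]
    rintro _ ⟨t, ht, rfl⟩
    rw [SetLike.mem_coe, LinearMap.mem_eqLocus, LinearMap.comp_apply]
    exact branchShift_branchShift_single (h t ht) 1
  have h' := this hv.1
  rwa [LinearMap.mem_eqLocus, LinearMap.comp_apply] at h'

/-- Infinitely many copies of the tree `T`. -/
def copies (T : Set (List ℕ)) : Set (List ℕ × ℕ) := {t | 1 ≤ t.2 ∧ t.1 ∈ T}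

/-- Infinitely many copies of the tree `T` together with a tree consisting of one branch. -/
def copiesWithBranch (T : Set (List ℕ)) : Set (List ℕ × ℕ) :=
  {t | t ∈ copies T ∨ t.2 = 0 ∧ t.1 = PiNat.res 0 t.1.length}

variable {T : Set (List ℕ)}

theorem nonempty_addEquiv_of_branch {y : ℕ → ℕ} (hy : ∀ n, PiNat.res y n ∈ T) :
    Nonempty (forestGroup r (copies T) ≃+ forestGroup r (copiesWithBranch T)) := by
  let b : ℕ → ℕ → ℕ := fun i => if i = 0 then 0 else y
  have hb : ∀ (σ : ℕ → ℕ) t, toBranch b σ t ∈ copiesWithBranch T := by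
    intro σ t
    by_cases h : σ t.2 = 0
    · right; simp [toBranch, h, b]
    · left; exact ⟨Nat.one_le_iff_ne_zero.2 h, by simpa [toBranch, h, b] using hy _⟩
  have hb' : ∀ (σ : ℕ → ℕ) t, σ t.2 ≠ 0 → toBranch b σ t ∈ copies T := fun σ t h =>
    ⟨Nat.one_le_iff_ne_zero.2 h, by simpa [toBranch, h, b] using hy _⟩
  have h1 : ∀ t ∈ copies T, branchShift b Nat.pred (Finsupp.single t 1) ∈
      Finsupp.supported ℚ ℚ (copiesWithBranch T) := by
    intro t ht
    rw [branchShift_single]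
    exact add_mem (sub_mem (Finsupp.single_mem_supported ℚ _ (Or.inl ht))
      (Finsupp.single_mem_supported ℚ _ (hb _ _))) (Finsupp.single_mem_supported ℚ _ (hb _ _))
  have h2 : ∀ t ∈ copiesWithBranch T, branchShift b Nat.succ (Finsupp.single t 1) ∈
      Finsupp.supported ℚ ℚ (copies T) := by
    rintro ⟨s, i⟩ ht
    rw [branchShift_single]
    refine add_mem ?_ (Finsupp.single_mem_supported ℚ _ (hb' _ _ (Nat.succ_ne_zero _)))
    rcases ht with ht | ⟨hi, hs⟩
    · exact sub_mem (Finsupp.single_mem_supported ℚ _ ht)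
        (Finsupp.single_mem_supported ℚ _ (hb' _ _ (Nat.one_le_iff_ne_zero.1 ht.1)))
    · dsimp only at hi hs
      have : toBranch b id (s, i) = (s, i) := by
        simp [toBranch, b, hi, ← hs]
      rw [this, sub_self]
      exact zero_mem _
  exact ⟨{
    toFun := fun v => ⟨_, branchShift_mem_forestGroup h1 v.2⟩
    invFun := fun v => ⟨_, branchShift_mem_forestGroup h2 v.2⟩
    left_inv := fun v => Subtype.ext <| branchShift_branchShift
      (fun t ht => Nat.succ_pred_eq_of_pos ht.1) v.2
    right_inv := fun v => Subtype.ext <| branchShift_branchShift (fun t _ => Nat.pred_succ _) v.2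
    map_add' := fun v w => Subtype.ext (map_add (branchShift b Nat.pred) v.1 w.1) }⟩

theorem exists_branch_of_addEquiv (hr : Function.Injective r)
    (κ : forestGroup r (copiesWithBranch T) ≃+ forestGroup r (copies T)) :
    ∃ y : ℕ → ℕ, ∀ n, PiNat.res y n ∈ T := by
  classical
  let node : ℕ → List ℕ × ℕ := fun n => (PiNat.res 0 n, 0)
  have hnode : ∀ n, node n ∈ copiesWithBranch T := fun n => Or.inr (by simp [node])
  have hone : ∀ m, padicNorm (r m) 1 ≤ 1 := fun m => by simp
  let star : ℕ → forestGroup r (copiesWithBranch T) := fun n =>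
    ⟨Finsupp.single (node n) 1, single_mem_forestGroup (hnode n) fun m _ => hone m⟩
  have hr0 : ∀ n, (r n : ℚ) ≠ 0 := fun n => Nat.cast_ne_zero.2 (Fact.out : (r n).Prime).ne_zero
  have hdiv : ∀ n k, ∃ y, r (2 * n) ^ k • y = star n := by
    intro n k
    refine ⟨⟨Finsupp.single (node n) ((r (2 * n) : ℚ) ^ k)⁻¹, single_mem_forestGroup (hnode n)
      fun m hm => padicNorm_inv_pow_le_one (hr.ne ?_) k⟩, Subtype.ext ?_⟩
    · simpa [node] using hm
    · simp [star, Finsupp.smul_single, hr0]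
  have hdiv' : ∀ n k, ∃ y, r (2 * n + 1) ^ k • y = star (n + 1) - star n := by
    intro n k
    refine ⟨⟨_, single_sub_single_mem_forestGroup (n := n) (c := ((r (2 * n + 1) : ℚ) ^ k)⁻¹)
      (hnode (n + 1)) (hnode n) (by simp [contractLevel, node])
      fun m hm => padicNorm_inv_pow_le_one (hr.ne hm) k⟩, Subtype.ext ?_⟩
    simp [star, smul_sub, Finsupp.smul_single, hr0]
  have hlevel : ∀ n t, (κ (star n)).1 t ≠ 0 → t.1.length = n := by
    intro n t ht
    by_contra hn
    refine ht (apply_eq_zero_of_divisible (fun k => ?_) hn)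
    obtain ⟨y, hy⟩ := hdiv n k
    exact ⟨κ y, by rw [← hy, map_nsmul]⟩
  have hcontract : ∀ n, (κ (star (n + 1))).1.mapDomain (contractLevel n) = (κ (star n)).1 := by
    intro n
    have h := mapDomain_contractLevel_eq_zero_of_divisible (n := n)
      (x := κ (star (n + 1) - star n)) fun k => by
        obtain ⟨y, hy⟩ := hdiv' n k
        exact ⟨κ y, by rw [← hy, map_nsmul]⟩
    have h' : ((κ (star (n + 1))).1 - (κ (star n)).1).mapDomain (contractLevel n) =
        (κ (star (n + 1))).1.mapDomain (contractLevel n) -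
          (κ (star n)).1.mapDomain (contractLevel n) :=
      map_sub (Finsupp.mapDomain.addMonoidHom (contractLevel n)) _ _
    rw [map_sub, AddSubgroup.coe_sub, h', sub_eq_zero] at h
    rw [h]
    conv_rhs => rw [← Finsupp.mapDomain_id (v := (κ (star n)).1)]
    refine Finsupp.mapDomain_congr fun t ht => ?_
    have := hlevel n t (Finsupp.mem_support_iff.1 ht)
    simp [contractLevel, this]
  have hstep : ∀ n t, (κ (star n)).1 t ≠ 0 →
      ∃ s, (κ (star (n + 1))).1 s ≠ 0 ∧ contractLevel n s = t := by
    intro n t ht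
    rw [← hcontract, ← Finsupp.mem_support_iff] at ht
    obtain ⟨s, hs, rfl⟩ := Finset.mem_image.1 (Finsupp.mapDomain_support ht)
    exact ⟨s, Finsupp.mem_support_iff.1 hs, rfl⟩
  have h0 : ∃ t, (κ (star 0)).1 t ≠ 0 := by
    by_contra! h
    have h1 : κ (star 0) = 0 := Subtype.ext (Finsupp.ext h)
    have h2 : star 0 = 0 := by simpa using h1
    have h3 := DFunLike.congr_fun (congrArg Subtype.val h2) (node 0)
    simp [star] at h3
  choose f hf hfc using hstep
  obtain ⟨t₀, ht₀⟩ := h0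
  let path : ∀ n, {t // (κ (star n)).1 t ≠ 0} := fun n =>
    Nat.rec ⟨t₀, ht₀⟩ (fun n t => ⟨f n t.1 t.2, hf n t.1 t.2⟩) n
  have hpath : ∀ n, contractLevel n (path (n + 1)).1 = (path n).1 := fun n => hfc n _ _
  have hlen : ∀ n, (path n).1.1.length = n := fun n => hlevel n _ (path n).2
  let y : ℕ → ℕ := fun n => (path (n + 1)).1.1.headD 0
  have hy : ∀ n, PiNat.res y n = (path n).1.1 := by
    intro n
    induction n with
    | zero => exact (List.length_eq_zero_iff.1 (hlen 0)).symm
    | succ n ih =>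
      rw [PiNat.res_succ, ih, ← hpath n, contractLevel, if_pos (hlen _)]
      have := hlen (n + 1)
      simp only [y]
      cases h : (path (n + 1)).1.1 with
      | nil => simp [h] at this
      | cons a l => simp
  refine ⟨y, fun n => ?_⟩
  rw [hy]
  have := (Finsupp.mem_supported _ _).1 (κ (star n)).2.1 (Finsupp.mem_support_iff.2 (path n).2)
  exact this.2

end Branch

theorem exists_measurable_reduction {P : Set ℕ} (hP : ∀ r ∈ P, Nat.Prime r)
    (hPco : {r | Nat.Prime r ∧ r ∉ P}.Infinite) {B : Set (ℕ → ℕ)} (hB : AnalyticSet B) :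
    ∃ h : (ℕ → ℕ) → (ℕ × ℕ → ℕ) × (ℕ × ℕ → ℕ), Measurable h ∧ B = h ⁻¹' EP P := by
  obtain ⟨R, hR0, hR⟩ := exists_tree_of_analyticSet hB
  let ρ := hPco.natEmbedding
  let r : ℕ → ℕ := fun n => ρ n
  have hr : Function.Injective r := Subtype.val_injective.comp ρ.injective
  have (n : ℕ) : Fact (r n).Prime := ⟨(ρ n).2.1⟩
  obtain ⟨_⟩ := nonempty_denumerable (List ℕ × ℕ →₀ ℚ)
  let e := Denumerable.eqv (List ℕ × ℕ →₀ ℚ)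
  let T : (ℕ → ℕ) → Set (List ℕ) := fun x => {s | R s (PiNat.res x s.length)}
  have hT : ∀ s, MeasurableSet {x | s ∈ T x} := fun s => measurableSet_res_mem s.length {m | R s m}
  have hmem : ∀ x, ([], 1) ∈ copies (T x) := fun x => ⟨le_rfl, hR0⟩
  have hinf (x) : Infinite (forestGroup r (copies (T x))) := infinite_forestGroup (hmem x)
  have hinf' (x) : Infinite (forestGroup r (copiesWithBranch (T x))) :=
    infinite_forestGroup (Or.inl (hmem x))
  have hcopies : ∀ t, MeasurableSet {x | t ∈ copies (T x)} := fun t =>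
    (MeasurableSet.const _).inter (hT t.1)
  refine ⟨fun x => (subgroupCode e (forestGroup r (copies (T x))),
    subgroupCode e (forestGroup r (copiesWithBranch (T x)))), ?_, ?_⟩
  · refine (measurable_subgroupCode e _ ?_).prodMk (measurable_subgroupCode e _ ?_)
    · exact measurableSet_mem_forestGroup hcopies
    · exact measurableSet_mem_forestGroup fun t => (hcopies t).union (MeasurableSet.const _)
  · ext x
    obtain ⟨θ, hθ⟩ := exists_equiv_subgroupCode e (forestGroup r (copies (T x)))
    obtain ⟨θ', hθ'⟩ := exists_equiv_subgroupCode e (forestGroup r (copiesWithBranch (T x)))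
    have hdiv : ∀ F : Set (List ℕ × ℕ), ∀ q ∈ P, ∀ v : forestGroup r F, ∃ w, q • w = v :=
      fun F q hq => forestGroup_divisible (hP q hq) fun n hn => (ρ n).2.2 (by
        rwa [show (ρ n : ℕ) = q from hn])
    rw [Set.mem_preimage, mem_EP_iff_nonempty_addEquiv θ hθ θ' hθ'
      (isTFPDivAbelianCode_of_equiv hP (hdiv _) θ hθ)
      (isTFPDivAbelianCode_of_equiv hP (hdiv _) θ' hθ'), hR]
    constructor
    · rintro ⟨y, hy⟩
      exact nonempty_addEquiv_of_branch (y := y) fun n => by simpa [T] using hy n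
    · rintro ⟨κ⟩
      obtain ⟨y, hy⟩ := exists_branch_of_addEquiv hr κ.symm
      exact ⟨y, fun n => by simpa [T] using hy n⟩

/-- For any set `𝒫` of primes which is coinfinite in the primes, the
relation of isomorphism of torsion-free `𝒫`-divisible abelian groups is a complete
analytic set: it is analytic, every analytic subset of Baire space is the preimage of it
under a Borel map, and in particular it is not Borel. -/
theorem stmt9 (P : Set ℕ) (hP : ∀ r ∈ P, Nat.Prime r)
    (hPco : {r | Nat.Prime r ∧ r ∉ P}.Infinite) :
    AnalyticSet (EP P) ∧
      (∀ B : Set (ℕ → ℕ), AnalyticSet B →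
        ∃ h : (ℕ → ℕ) → (ℕ × ℕ → ℕ) × (ℕ × ℕ → ℕ), Measurable h ∧ B = h ⁻¹' EP P) ∧
      ¬ MeasurableSet (EP P) := by
  refine ⟨analyticSet_EP P, fun B hB => exists_measurable_reduction hP hPco hB, fun hm => ?_⟩
  obtain ⟨B, hB, hBm⟩ := exists_analyticSet_not_measurableSet
  obtain ⟨h, hh, rfl⟩ := exists_measurable_reduction hP hPco hB
  exact hBm (hh hm)
end

section
/- There is a Borel function that assigns to every (code for a) dimension group G = (G, G⁺, u) ∈ 𝒟𝒢 a Bratteli diagram (l^G, w^G, m^G) ∈ 𝓑𝒟 such that the dimension group associated with the Bratteli diagram (l^G, w^G, m^G) is isomorphic to G as an ordered abelian group with order unit (i.e., there is a group isomorphism mapping the positive cone onto the positive cone and the order unit to the order unit). -/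
open Finset

/-- `codeSmul f e x n` is `n • x` in the (additively written) group coded by `f` with
identity `e`. -/
def codeSmul (f : ℕ × ℕ → ℕ) (e x : ℕ) : ℕ → ℕ
  | 0 => e
  | n + 1 => f (x, codeSmul f e x n)

/-- The order on the group coded by `f` with positive cone `{d | P d = true}`:
`x ≤ y` iff `y = x + d` for some `d` in the cone. -/
def codeLe (f : ℕ × ℕ → ℕ) (P : ℕ → Bool) (x y : ℕ) : Prop :=
  ∃ d, P d = true ∧ f (x, d) = y

/-- `(f, P, u)` codes a dimension group: an unperforated ordered abelian group with the
Riesz interpolation property, with positive cone `{x | P x = true}` and order unit `u`. -/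
def IsDimGroupCode (f : ℕ × ℕ → ℕ) (P : ℕ → Bool) (u : ℕ) : Prop :=
  IsGroupCode f ∧ (∀ a b, f (a, b) = f (b, a)) ∧
  (∀ a b, P a = true → P b = true → P (f (a, b)) = true) ∧
  ∀ e, IsIdentityOf f e →
    P e = true ∧
    -- `G⁺ ∩ (−G⁺) = {0}`
    (∀ a b, P a = true → P b = true → f (a, b) = e → a = e) ∧
    -- `G⁺ − G⁺ = G`
    (∀ x, ∃ a b, P a = true ∧ P b = true ∧ f (x, b) = a) ∧
    -- unperforated
    (∀ x n, 1 ≤ n → P (codeSmul f e x n) = true → P x = true) ∧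
    -- Riesz interpolation
    (∀ x0 x1 y0 y1, codeLe f P x0 y0 → codeLe f P x0 y1 →
      codeLe f P x1 y0 → codeLe f P x1 y1 →
      ∃ z, codeLe f P x0 z ∧ codeLe f P x1 z ∧ codeLe f P z y0 ∧ codeLe f P z y1) ∧
    -- `u` is an order unit: `u ∈ G⁺` and for every `x` there is `n` with
    -- `x ≤ n·u` and `−n·u ≤ x` (the latter says `x + n·u ∈ G⁺`).
    (P u = true ∧ ∀ x, ∃ n, codeLe f P x (codeSmul f e u n) ∧
      P (f (x, codeSmul f e u n)) = true)

/-- The standard Borel space `𝒟𝒢` of codes for dimension groups. -/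
def DGCode : Set ((ℕ × ℕ → ℕ) × (ℕ → Bool) × ℕ) :=
  {x | IsDimGroupCode x.1 x.2.1 x.2.2}

/-- `(l, w, m)` is a Bratteli diagram. -/
def IsBratteli (l : ℕ → ℕ) (w : ℕ → ℕ → ℕ) (m : ℕ → ℕ × ℕ → ℕ) : Prop :=
  l 0 = 1 ∧ w 0 0 = 1 ∧ (∀ n i, 0 < w n i ↔ i < l n) ∧
  (∀ n i j, l n ≤ i ∨ l (n + 1) ≤ j → m n (i, j) = 0) ∧
  ∀ n j, j < l (n + 1) → w (n + 1) j = ∑ i ∈ range (l n), m n (i, j) * w n i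

/-- The standard Borel space `𝓑𝒟` of Bratteli diagrams. -/
def BDCode : Set ((ℕ → ℕ) × (ℕ → ℕ → ℕ) × (ℕ → ℕ × ℕ → ℕ)) :=
  {x | IsBratteli x.1 x.2.1 x.2.2}

/-- The connecting homomorphism `ℤ^{l(n)} → ℤ^{l(n+1)}`, `φ_n(e_i) = Σ_j m_n(i,j)·e_j`,
of the inductive system associated with a Bratteli diagram (vectors in `ℤ^{l(n)}` are
represented as finitely supported functions `ℕ → ℤ` vanishing at indices `≥ l(n)`). -/
def stepMap (l : ℕ → ℕ) (m : ℕ → ℕ × ℕ → ℕ) (n : ℕ) (x : ℕ → ℤ) : ℕ → ℤ :=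
  fun j => if j < l (n + 1) then ∑ i ∈ range (l n), (m n (i, j) : ℤ) * x i else 0

/-- The composite connecting map from level `n` to level `n + k`. -/
def iterStep (l : ℕ → ℕ) (m : ℕ → ℕ × ℕ → ℕ) (n : ℕ) : ℕ → (ℕ → ℤ) → ℕ → ℤ
  | 0 => fun x => x
  | k + 1 => fun x => stepMap l m (n + k) (iterStep l m n k x)

/-- `x : ℕ → ℤ` represents an element of `ℤ^{l(n)}`. -/
def SuppLt (l : ℕ → ℕ) (n : ℕ) (x : ℕ → ℤ) : Prop :=
  ∀ i, l n ≤ i → x i = 0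

/-- The order unit `(w_n(0), …, w_n(l(n)−1))` of `ℤ^{l(n)}`. -/
def unitVec (l : ℕ → ℕ) (w : ℕ → ℕ → ℕ) (n : ℕ) : ℕ → ℤ :=
  fun i => if i < l n then (w n i : ℤ) else 0

/-- `θ` codes an isomorphism of ordered abelian groups with order unit from the dimension
group associated with the Bratteli diagram `(l, w, m)` (the direct limit of the system
`(ℤ^{l(n)}, ℕ^{l(n)}, w_n)` with connecting maps `stepMap`) onto the dimension group
coded by `(f, P, u)`.  `θ n` is the composition of the canonical map
`φ_{n,∞} : ℤ^{l(n)} → lim` with the isomorphism: the conditions say that each `θ n` is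
additive, compatible with the connecting maps, jointly surjective; that `θ n x = 0` iff
`x` is eventually killed by the connecting maps (injectivity on the limit); that
`θ n x ≥ 0` iff `x` is eventually mapped into the positive cone `ℕ^{l(n+k)}` (order
isomorphism); and that the order unit is mapped to `u`. -/
def IsLimitIso (l : ℕ → ℕ) (w : ℕ → ℕ → ℕ) (m : ℕ → ℕ × ℕ → ℕ)
    (f : ℕ × ℕ → ℕ) (P : ℕ → Bool) (u : ℕ) (θ : ℕ → (ℕ → ℤ) → ℕ) : Prop :=
  ∀ e, IsIdentityOf f e →
    (∀ n x y, SuppLt l n x → SuppLt l n y →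
      θ n (fun i => x i + y i) = f (θ n x, θ n y)) ∧
    (∀ n x, SuppLt l n x → θ (n + 1) (stepMap l m n x) = θ n x) ∧
    (∀ g : ℕ, ∃ n x, SuppLt l n x ∧ θ n x = g) ∧
    (∀ n x, SuppLt l n x → (θ n x = e ↔ ∃ k, iterStep l m n k x = fun _ => 0)) ∧
    (∀ n x, SuppLt l n x →
      (P (θ n x) = true ↔ ∃ k, ∀ j, 0 ≤ iterStep l m n k x j)) ∧
    θ 0 (unitVec l w 0) = u

section Riesz

variable {G : Type*} [AddCommGroup G] [PartialOrder G]

/-- Riesz interpolation property. -/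
def RieszInterpolation (G : Type*) [PartialOrder G] : Prop :=
  ∀ x₀ x₁ y₀ y₁ : G, x₀ ≤ y₀ → x₀ ≤ y₁ → x₁ ≤ y₀ → x₁ ≤ y₁ →
    ∃ z, x₀ ≤ z ∧ x₁ ≤ z ∧ z ≤ y₀ ∧ z ≤ y₁

/-- An ordered group is unperforated if `n • a ≥ 0` with `n ≥ 1` implies `a ≥ 0`. -/
def Unperforated (G : Type*) [AddCommGroup G] [PartialOrder G] : Prop :=
  ∀ (a : G) (n : ℕ), 1 ≤ n → 0 ≤ n • a → 0 ≤ a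

theorem RieszInterpolation.exists_sum_eq [IsOrderedAddMonoid G] (hR : RieszInterpolation G)
    {ι : Type*} [DecidableEq ι] (s : Finset ι) (x : ι → G) (hx : ∀ i ∈ s, 0 ≤ x i) :
    ∀ p : G, 0 ≤ p → p ≤ ∑ i ∈ s, x i →
      ∃ c : ι → G, (∀ i ∈ s, 0 ≤ c i ∧ c i ≤ x i) ∧ ∑ i ∈ s, c i = p := by
  induction s using Finset.induction_on with
  | empty =>
    intro p hp hp'
    exact ⟨0, by simp, by simpa using le_antisymm hp (by simpa using hp')⟩
  | insert a s ha ih =>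
    intro p hp hp'
    rw [Finset.sum_insert ha] at hp'
    have hs : 0 ≤ ∑ i ∈ s, x i := sum_nonneg fun i hi => hx i (mem_insert_of_mem hi)
    obtain ⟨z, h0z, hz, hzx, hzp⟩ := hR 0 (p - ∑ i ∈ s, x i) (x a) p
      (hx a (mem_insert_self a s)) hp (sub_le_iff_le_add.2 hp') (sub_le_self p hs)
    obtain ⟨c, hc, hcs⟩ := ih (fun i hi => hx i (mem_insert_of_mem hi)) (p - z)
      (sub_nonneg.2 hzp) (sub_le_comm.1 hz)
    refine ⟨Function.update c a z, fun i hi => ?_, ?_⟩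
    · rcases eq_or_ne i a with rfl | hia
      · simpa using ⟨h0z, hzx⟩
      · simpa [hia] using hc i ((mem_insert.1 hi).resolve_left hia)
    · rw [Finset.sum_insert ha, Function.update_self,
        sum_congr rfl fun i hi => Function.update_of_ne (ne_of_mem_of_not_mem hi ha) z c, hcs]
      abel

/-- The family `p` is refined by positive elements `q j`, i.e. the `p i` are combinations of the
`q j` with coefficients in `ℕ`, in such a way that every relation in `s` between the `p i`
becomes trivial in terms of the `q j`. -/
def HasRefinement {ι : Type} [Fintype ι] (p : ι → G) (s : Set (ι → ℤ)) : Prop :=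
  ∃ (κ : Type) (_ : Fintype κ) (q : κ → G) (M : ι → κ → ℕ),
    (∀ j, 0 ≤ q j) ∧ (∀ i, p i = ∑ j, M i j • q j) ∧ ∀ a ∈ s, ∀ j, ∑ i, a i * (M i j : ℤ) = 0

theorem HasRefinement.comp {ι κ : Type} [Fintype ι] [Fintype κ] {p : ι → G} {q : κ → G}
    {s : Set (ι → ℤ)} {t : Set (κ → ℤ)}
    (M : ι → κ → ℕ) (hpq : ∀ i, p i = ∑ j, M i j • q j)
    (hst : ∀ a ∈ s, (fun j => ∑ i, a i * (M i j : ℤ)) ∈ t) (h : HasRefinement q t) :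
    HasRefinement p s := by
  obtain ⟨τ, _, r, N, hr, hqr, hN⟩ := h
  refine ⟨τ, inferInstance, r, fun i k => ∑ j, M i j * N j k, hr, fun i => ?_, fun a ha k => ?_⟩
  · simp_rw [hpq i, hqr, Finset.smul_sum, Finset.sum_smul, mul_smul]
    exact sum_comm
  · have := hN _ (hst a ha) k
    simp only [Finset.sum_mul] at this
    rw [sum_comm] at this
    rw [← this]
    refine sum_congr rfl fun i _ => ?_
    push_cast
    rw [Finset.mul_sum]
    exact sum_congr rfl fun j _ => by ring

theorem HasRefinement.refl {ι : Type} [Fintype ι] [DecidableEq ι] {p : ι → G} (hp : ∀ i, 0 ≤ p i)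
    {s : Set (ι → ℤ)} (hs : ∀ a ∈ s, a = 0) : HasRefinement p s :=
  ⟨ι, inferInstance, p, fun i j => if i = j then 1 else 0, hp, fun i => by simp [ite_smul],
    fun a ha j => by simp [hs a ha]⟩

theorem HasRefinement.neg {ι : Type} [Fintype ι] {p : ι → G} {a : ι → ℤ}
    (h : HasRefinement p {-a}) : HasRefinement p {a} := by
  obtain ⟨κ, _, q, M, hq, hpq, hM⟩ := h
  refine ⟨κ, inferInstance, q, M, hq, hpq, ?_⟩
  rintro _ rfl j
  simpa using hM _ rfl j

theorem HasRefinement.insert_zero {ι : Type} [Fintype ι] {p : ι → G} {a : ι → ℤ}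
    (h : HasRefinement p {a}) : HasRefinement p {a, 0} := by
  obtain ⟨κ, _, q, M, hq, hpq, hM⟩ := h
  refine ⟨κ, inferInstance, q, M, hq, hpq, ?_⟩
  rintro _ (rfl | rfl) j
  · exact hM _ rfl j
  · simp

/-- A positive element whose coefficient in a relation is maximal is at most the sum of the
elements with negative coefficients. -/
theorem Unperforated.le_sum_neg [IsOrderedAddMonoid G] (hU : Unperforated G) {ι : Type}
    [Fintype ι] [DecidableEq ι]
    {p : ι → G} (hp : ∀ i, 0 ≤ p i) {a : ι → ℤ} (ha : ∑ i, a i • p i = 0) {m : ℕ} (hm : 0 < m)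
    (ham : ∀ i, |a i| ≤ m) {i₀ : ι} (hi₀ : a i₀ = m) :
    p i₀ ≤ ∑ i with a i < 0, p i := by
  refine sub_nonneg.1 (hU _ m hm ?_)
  have key : m • (∑ i with a i < 0, p i - p i₀) =
      ∑ i, ((a i + if a i < 0 then (m : ℤ) else 0) • p i) - (m : ℤ) • p i₀ := by
    simp only [add_smul, ite_smul, zero_smul, sum_add_distrib, ha, zero_add]
    rw [smul_sub, Finset.smul_sum, Finset.sum_filter]
    simp
  rw [key, ← Finset.add_sum_erase _ _ (mem_univ i₀), if_neg (by omega), add_zero, hi₀,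
    add_sub_cancel_left]
  refine sum_nonneg fun i _ => zsmul_nonneg (hp i) ?_
  have := abs_le.1 (ham i)
  split_ifs <;> omega

theorem hasRefinement_singleton [IsOrderedAddMonoid G] (hR : RieszInterpolation G)
    (hU : Unperforated G) (m : ℕ) :
    ∀ (c : ℕ) (ι : Type) [Fintype ι] [DecidableEq ι] (p : ι → G) (a : ι → ℤ),
      (∀ i, 0 ≤ p i) → ∑ i, a i • p i = 0 → (∀ i, |a i| ≤ m) →
        (univ.filter fun i => |a i| = m).card ≤ c → HasRefinement p {a} := by
  induction m with
  | zero =>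
    intro c ι _ _ p a hp _ ham _
    refine .refl hp ?_
    rintro _ rfl
    exact funext fun i => abs_nonpos_iff.1 (by simpa using ham i)
  | succ m ihm =>
    intro c
    induction c with
    | zero =>
      intro ι _ _ p a hp ha ham hc
      refine ihm _ ι p a hp ha (fun i => ?_) le_rfl
      have h1 : |a i| ≠ (m + 1 : ℕ) := fun h => by
        have : i ∈ (∅ : Finset ι) := (card_eq_zero.1 (Nat.le_zero.1 hc)) ▸ by simpa using h
        simp at this
      have := ham i
      omega
    | succ c ihc =>
      intro ι _ _ p a hp ha ham hc
      by_cases hex : ∃ i₀, |a i₀| = (m + 1 : ℕ)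
      swap
      · exact ihc ι p a hp ha ham (by
          rw [filter_false_of_mem fun i _ h => hex ⟨i, h⟩]
          exact Nat.zero_le _)
      wlog hpos : ∃ i₀, a i₀ = (m + 1 : ℕ) generalizing a
      · refine .neg (this (-a) (by simpa using ha) (by simpa using ham) (by simpa using hc)
          (by simpa using hex) ?_)
        obtain ⟨i, hi⟩ := hex
        refine ⟨i, ?_⟩
        rcases (abs_eq (by positivity)).1 hi with h | h
        · exact absurd ⟨i, h⟩ hpos
        · simp [h]
      obtain ⟨i₀, hi₀⟩ := hpos
      obtain ⟨d, hd, hsum⟩ := hR.exists_sum_eq {i | a i < 0} p (fun i _ => hp i) (p i₀) (hp i₀)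
        (hU.le_sum_neg hp ha m.succ_pos ham hi₀)
      -- `inl i` stands for what is left of `p i`, `inr i` for the part of `p i` below `p i₀`.
      let M : ι → ι ⊕ ι → ℕ := fun i => Sum.elim (fun k => if i = k ∧ k ≠ i₀ then 1 else 0)
        (fun k => if a k < 0 then (if i = i₀ then 1 else 0) + (if i = k then 1 else 0) else 0)
      let q : ι ⊕ ι → G := Sum.elim
        (fun k => if k = i₀ then 0 else if a k < 0 then p k - d k else p k)
        (fun k => if a k < 0 then d k else 0)
      have hpq : ∀ i, p i = ∑ j, M i j • q j := by
        intro i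
        have hl : ∑ k, M i (.inl k) • q (.inl k) = q (.inl i) := by
          rw [sum_eq_single i (fun k _ hk => by simp [M, hk.symm]) (by simp)]
          by_cases h : i = i₀ <;> simp [M, q, h]
        have hr : ∑ k, M i (.inr k) • q (.inr k) = (if i = i₀ then p i₀ else 0) + q (.inr i) := by
          have : ∀ k, M i (.inr k) • q (.inr k) =
              (if i = i₀ then (if a k < 0 then d k else 0) else 0) +
                (if i = k then q (.inr k) else 0) := by
            intro k
            simp only [M, q, Sum.elim_inr]
            split_ifs <;> simp [two_smul]
          simp_rw [this, sum_add_distrib, Finset.sum_ite_eq, mem_univ, if_true]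
          congr 1
          split_ifs
          · rw [← hsum, Finset.sum_filter]
          · simp
        rw [Fintype.sum_sum_type, hl, hr]
        simp only [q, Sum.elim_inl, Sum.elim_inr]
        rcases eq_or_ne i i₀ with rfl | h
        · simp [hi₀, show ¬ ((m : ℤ) + 1 < 0) by omega]
        · simp only [h, if_false]
          split_ifs <;> abel
      let b : ι ⊕ ι → ℤ := fun j => ∑ i, a i * (M i j : ℤ)
      have hbl : ∀ k, b (.inl k) = if k = i₀ then 0 else a k := by
        intro k
        simp only [b, M, Sum.elim_inl]
        rw [sum_eq_single k (fun i _ hi => by simp [hi]) (by simp)]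
        by_cases h : k = i₀ <;> simp [h]
      have hbr : ∀ k, b (.inr k) = if a k < 0 then (m + 1 : ℕ) + a k else 0 := by
        intro k
        simp only [b, M, Sum.elim_inr]
        split_ifs
        · simp [mul_add, sum_add_distrib, hi₀]
        · simp
      refine .comp (t := {b}) M hpq (by simp [b]) (ihc (ι ⊕ ι) q b ?_ ?_ ?_ ?_)
      · rintro (k | k)
        · simp only [q, Sum.elim_inl]
          split_ifs with h1 h2
          · exact le_rfl
          · exact sub_nonneg.2 (hd k (by simpa using h2)).2
          · exact hp k
        · simp only [q, Sum.elim_inr]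
          split_ifs with h2
          · exact (hd k (by simpa using h2)).1
          · exact le_rfl
      · rw [← ha]
        simp_rw [hpq, Finset.smul_sum, b, Finset.sum_smul, mul_smul, natCast_zsmul]
        exact sum_comm
      · rintro (k | k)
        · rw [hbl]
          split_ifs
          · simp; omega
          · exact ham k
        · rw [hbr]
          have := abs_le.1 (ham k)
          split_ifs
          · rw [abs_le]; omega
          · simp; omega
      · refine Nat.le_of_lt_succ (lt_of_lt_of_le ?_ hc)
        have hsub : (univ.filter fun j => |b j| = (m + 1 : ℕ)) ⊆
            ((univ.filter fun i => |a i| = (m + 1 : ℕ)).erase i₀).map .inl := by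
          rintro (k | k) hk
          · rw [mem_filter, hbl] at hk
            split_ifs at hk with h
            · simp at hk; omega
            · simpa [h] using hk.2
          · rw [mem_filter, hbr] at hk
            have := abs_le.1 (ham k)
            split_ifs at hk
            · rw [abs_of_nonneg (by omega)] at hk; omega
            · simp at hk; omega
        refine (card_le_card hsub).trans_lt ?_
        rw [card_map]
        exact card_erase_lt_of_mem (by simp [hi₀]; omega)

theorem hasRefinement_ker [IsOrderedAddMonoid G] (hR : RieszInterpolation G) (hU : Unperforated G)
    {ι : Type} [Fintype ι] (p : ι → G) (hp : ∀ i, 0 ≤ p i) :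
    HasRefinement p {a | ∑ i, a i • p i = 0} := by
  classical
  have key : ∀ (s : Finset (ι → ℤ)), (∀ a ∈ s, ∑ i, a i • p i = 0) → HasRefinement p ↑s := by
    intro s
    induction s using Finset.induction_on with
    | empty => exact fun _ => .refl hp (by simp)
    | insert a s _ ih =>
      intro h
      obtain ⟨κ, _, q, M, hq, hpq, hM⟩ := ih fun b hb => h b (mem_insert_of_mem hb)
      refine .comp (t := {fun j => ∑ i, a i * (M i j : ℤ), 0}) M hpq ?_ ?_
      · intro b hb
        rcases mem_insert.1 (mem_coe.1 hb) with rfl | hb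
        · simp
        · exact .inr (funext fun j => hM b hb j)
      · refine .insert_zero (hasRefinement_singleton hR hU
          (∑ j, (∑ i, a i * (M i j : ℤ)).natAbs) _ κ q _ hq ?_ (fun j => ?_) le_rfl)
        · rw [← h a (mem_insert_self a s)]
          simp_rw [hpq, Finset.smul_sum, Finset.sum_smul, mul_smul, natCast_zsmul]
          exact sum_comm
        · rw [Int.abs_eq_natAbs, Nat.cast_le]
          exact single_le_sum (f := fun j => (∑ i, a i * (M i j : ℤ)).natAbs)
            (fun _ _ => Nat.zero_le _) (mem_univ j)
  let K : Submodule ℤ (ι → ℤ) := LinearMap.ker (Fintype.linearCombination ℤ p)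
  have hK : ∀ a, a ∈ K ↔ ∑ i, a i • p i = 0 := fun a => by
    simp [K, Fintype.linearCombination_apply]
  obtain ⟨s, hs⟩ := IsNoetherian.noetherian K
  obtain ⟨κ, _, q, M, hq, hpq, hM⟩ :=
    key s fun a ha => (hK a).1 (hs ▸ Submodule.subset_span ha)
  refine ⟨κ, inferInstance, q, M, hq, hpq, fun a ha j => ?_⟩
  have ha' : a ∈ Submodule.span ℤ (s : Set (ι → ℤ)) := hs ▸ (hK a).2 ha
  clear ha
  induction ha' using Submodule.span_induction with
  | mem x hx => exact hM x hx j
  | zero => simp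
  | add x y _ _ hx hy => simp [add_mul, sum_add_distrib, hx, hy]
  | smul c x _ hx => simp [mul_assoc, ← Finset.mul_sum, hx]

end Riesz

section System

variable {G : Type*} [AddCommGroup G]

/-- The value in `G` of the vector `x` at level `n`, where the `i`-th basis vector of level `n`
is sent to `g n i`. -/
def levelValue (l : ℕ → ℕ) (g : ℕ → ℕ → G) (n : ℕ) (x : ℕ → ℤ) : G :=
  ∑ i ∈ range (l n), x i • g n i

theorem levelValue_add (l : ℕ → ℕ) (g : ℕ → ℕ → G) (n : ℕ) (x y : ℕ → ℤ) :
    levelValue l g n (fun i => x i + y i) = levelValue l g n x + levelValue l g n y := by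
  simp [levelValue, add_smul, sum_add_distrib]

theorem levelValue_sub (l : ℕ → ℕ) (g : ℕ → ℕ → G) (n : ℕ) (x y : ℕ → ℤ) :
    levelValue l g n (fun i => x i - y i) = levelValue l g n x - levelValue l g n y := by
  simp [levelValue, sub_smul]

variable [PartialOrder G]

theorem exists_extension [IsOrderedAddMonoid G] (hR : RieszInterpolation G) (hU : Unperforated G)
    {u : G} (hu : ∀ x : G, ∃ n : ℕ, x ≤ n • u) {l : ℕ} {w : ℕ → ℕ} {p : ℕ → G}
    (hp : ∀ i < l, 0 ≤ p i) (hw : ∀ i < l, 0 < w i) (hwp : ∑ i ∈ range l, w i • p i = u) (a : G) :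
    ∃ (l' : ℕ) (m : ℕ → ℕ → ℕ) (q : ℕ → G), (∀ j < l', 0 ≤ q j) ∧
      (∀ i < l, p i = ∑ j ∈ range l', m i j • q j) ∧
      (∀ i j, l ≤ i ∨ l' ≤ j → m i j = 0) ∧
      (∀ j < l', 0 < ∑ i ∈ range l, m i j * w i) ∧
      (∀ v : ℕ → ℤ, ∑ i ∈ range l, v i • p i = 0 →
        ∀ j < l', ∑ i ∈ range l, (m i j : ℤ) * v i = 0) ∧
      (0 ≤ a → ∃ v : ℕ → ℕ, ∑ j ∈ range l', v j • q j = a) := by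
  classical
  wlog ha : 0 ≤ a generalizing a
  · obtain ⟨l', m, q, h1, h2, h3, h4, h5, -⟩ := this 0 le_rfl
    exact ⟨l', m, q, h1, h2, h3, h4, h5, fun h => absurd h ha⟩
  obtain ⟨N, hN⟩ := hu a
  let p' : Fin l ⊕ Bool → G := Sum.elim (fun i => p i) fun b => if b then a else N • u - a
  have hp' : ∀ i, 0 ≤ p' i := by
    rintro (i | _ | _)
    · exact hp i i.2
    · simpa [p'] using hN
    · simpa [p'] using ha
  obtain ⟨κ, _, q, M, hq, hpq, hM⟩ := hasRefinement_ker hR hU p' hp'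
  let W : κ → ℕ := fun j => ∑ i : Fin l, M (.inl i) j * w i
  have hNW : ∀ j, N * W j = M (.inr true) j + M (.inr false) j := by
    intro j
    have := hM (Sum.elim (fun i => (N : ℤ) * w i) fun _ => -1) (by
      have : ∑ i : Fin l, ((N : ℤ) * w i) • p i = N • u := by
        rw [← hwp, Finset.sum_range, Finset.smul_sum]
        exact sum_congr rfl fun i _ => by rw [mul_smul, natCast_zsmul, natCast_zsmul]
      simp [p', this]
      abel) j
    simp only [Fintype.sum_sum_type, Sum.elim_inl, Sum.elim_inr, Fintype.sum_bool] at this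
    zify
    have h2 : (N : ℤ) * ∑ i : Fin l, (M (.inl i) j : ℤ) * w i =
        ∑ i : Fin l, (N : ℤ) * w i * M (.inl i) j := by
      rw [Finset.mul_sum]
      exact sum_congr rfl fun i _ => by ring
    simp only [W, Nat.cast_sum, Nat.cast_mul, h2]
    linarith
  have hW0 : ∀ j, W j = 0 → (∀ i : Fin l, M (.inl i) j = 0) ∧ M (.inr true) j = 0 := by
    intro j hj
    refine ⟨fun i => ?_, ?_⟩
    · have := (Finset.sum_eq_zero_iff.1 hj) i (mem_univ i)
      exact (Nat.mul_eq_zero.1 this).resolve_right (hw i i.2).ne'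
    · have := hNW j
      rw [hj, mul_zero] at this
      omega
  let e := Fintype.equivFin {j // 0 < W j}
  set l' := Fintype.card {j // 0 < W j}
  let t : Fin l' → κ := fun x => (e.symm x).1
  have hsum : ∀ h : κ → G, (∀ j, W j = 0 → h j = 0) → ∑ j, h j = ∑ x, h (t x) := by
    intro h hh
    rw [Equiv.sum_comp e.symm fun j => h j.1,
      ← Finset.sum_subtype (univ.filter fun j => 0 < W j) (by simp) h,
      Finset.sum_filter_of_ne fun j _ hj => Nat.pos_of_ne_zero fun h0 => hj (hh j h0)]
  refine ⟨l', fun i j => if h : i < l ∧ j < l' then M (.inl ⟨i, h.1⟩) (t ⟨j, h.2⟩) else 0,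
    fun j => if h : j < l' then q (t ⟨j, h⟩) else 0, ?_, ?_, ?_, ?_, ?_, fun _ =>
    ⟨fun j => if h : j < l' then M (.inr true) (t ⟨j, h⟩) else 0, ?_⟩⟩
  · intro j hj
    simpa [hj] using hq _
  · intro i hi
    have := hpq (.inl ⟨i, hi⟩)
    rw [hsum _ fun j hj => by simp [(hW0 j hj).1]] at this
    simpa [Finset.sum_range, hi, p'] using this
  · intro i j h
    exact dif_neg (by omega)
  · intro j hj
    have := (e.symm ⟨j, hj⟩).2
    simpa [Finset.sum_range, hj, W] using this
  · intro v hv j hj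
    have := hM (Sum.elim (fun i => v i) fun _ => 0) (by
      simpa [Finset.sum_range, p'] using hv) (t ⟨j, hj⟩)
    simpa [Finset.sum_range, hj, mul_comm] using this
  · have := hpq (.inr true)
    rw [hsum _ fun j hj => by simp [(hW0 j hj).2]] at this
    simpa [Finset.sum_range, p'] using this.symm

/-- Positive elements `g n i` that realise `G` as the limit of the inductive system `(l, m)`:
every relation at level `n` is killed at level `n + 1`, and the `n`-th element of the enumeration
`a` of `G`, if positive, comes from a positive vector at level `n + 1`. -/
structure IsLimitSystem (l : ℕ → ℕ) (m : ℕ → ℕ × ℕ → ℕ) (g : ℕ → ℕ → G) (a : ℕ → G) : Prop where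
  nonneg : ∀ n, ∀ i < l n, 0 ≤ g n i
  compat : ∀ n, ∀ i < l n, g n i = ∑ j ∈ range (l (n + 1)), m n (i, j) • g (n + 1) j
  ker : ∀ n (v : ℕ → ℤ), levelValue l g n v = 0 →
    ∀ j < l (n + 1), ∑ i ∈ range (l n), (m n (i, j) : ℤ) * v i = 0
  gen : ∀ n, 0 ≤ a n → ∃ v : ℕ → ℕ, levelValue l g (n + 1) (fun i => v i) = a n

namespace IsLimitSystem

variable {l : ℕ → ℕ} {m : ℕ → ℕ × ℕ → ℕ} {g : ℕ → ℕ → G} {a : ℕ → G}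

theorem levelValue_stepMap (h : IsLimitSystem l m g a) (n : ℕ) (x : ℕ → ℤ) :
    levelValue l g (n + 1) (stepMap l m n x) = levelValue l g n x := by
  have h1 : levelValue l g n x = ∑ i ∈ range (l n), ∑ j ∈ range (l (n + 1)),
      ((m n (i, j) : ℤ) * x i) • g (n + 1) j := by
    refine sum_congr rfl fun i hi => ?_
    rw [h.compat n i (mem_range.1 hi), Finset.smul_sum]
    exact sum_congr rfl fun j _ => by rw [mul_comm, mul_smul, natCast_zsmul]
  rw [h1, sum_comm]
  refine sum_congr rfl fun j hj => ?_
  rw [stepMap, if_pos (mem_range.1 hj), Finset.sum_smul]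

theorem levelValue_iterStep (h : IsLimitSystem l m g a) (n : ℕ) (x : ℕ → ℤ) (k : ℕ) :
    levelValue l g (n + k) (iterStep l m n k x) = levelValue l g n x := by
  induction k with
  | zero => rfl
  | succ k ih => rw [← ih]; exact h.levelValue_stepMap _ _

theorem levelValue_nonneg [IsOrderedAddMonoid G] (h : IsLimitSystem l m g a) {n : ℕ} {x : ℕ → ℤ}
    (hx : ∀ i, 0 ≤ x i) : 0 ≤ levelValue l g n x :=
  sum_nonneg fun i hi => zsmul_nonneg (h.nonneg n i (mem_range.1 hi)) (hx i)

theorem stepMap_eq_zero (h : IsLimitSystem l m g a) {n : ℕ} {x : ℕ → ℤ}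
    (hx : levelValue l g n x = 0) : stepMap l m n x = fun _ => 0 := by
  funext j
  rw [stepMap]
  split_ifs with hj
  · exact h.ker n x hx j hj
  · rfl

theorem stepMap_nonneg {n : ℕ} {x : ℕ → ℤ} (hx : ∀ i, 0 ≤ x i) (j : ℕ) :
    0 ≤ stepMap l m n x j := by
  rw [stepMap]
  split_ifs
  · exact sum_nonneg fun i _ => mul_nonneg (Nat.cast_nonneg _) (hx i)
  · exact le_rfl

theorem iterStep_nonneg {n : ℕ} {x : ℕ → ℤ} (hx : ∀ i, 0 ≤ x i) (k : ℕ) :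
    ∀ j, 0 ≤ iterStep l m n k x j := by
  induction k with
  | zero => exact hx
  | succ k ih => exact stepMap_nonneg ih

theorem stepMap_sub (n : ℕ) (x y : ℕ → ℤ) :
    stepMap l m n (fun i => x i - y i) = fun j => stepMap l m n x j - stepMap l m n y j := by
  funext j
  simp only [stepMap]
  split_ifs <;> simp [mul_sub]

theorem exists_nonneg (h : IsLimitSystem l m g a) (ha : Function.Surjective a) {b : G}
    (hb : 0 ≤ b) : ∃ N, ∀ n ≥ N, ∃ x : ℕ → ℤ, (∀ i, 0 ≤ x i) ∧ levelValue l g n x = b := by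
  obtain ⟨N, rfl⟩ := ha b
  obtain ⟨v, hv⟩ := h.gen N hb
  refine ⟨N + 1, fun n hn => ?_⟩
  obtain ⟨k, rfl⟩ := Nat.exists_eq_add_of_le hn
  exact ⟨iterStep l m (N + 1) k fun i => v i, iterStep_nonneg (fun i => by simp) k, by
    rw [h.levelValue_iterStep, hv]⟩

theorem exists_levelValue_eq (h : IsLimitSystem l m g a) (ha : Function.Surjective a)
    (hG : ∀ x : G, ∃ b c, 0 ≤ b ∧ 0 ≤ c ∧ x = b - c) (b : G) :
    ∃ n x, SuppLt l n x ∧ levelValue l g n x = b := by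
  obtain ⟨b, c, hb, hc, rfl⟩ := hG b
  obtain ⟨N₁, h₁⟩ := h.exists_nonneg ha hb
  obtain ⟨N₂, h₂⟩ := h.exists_nonneg ha hc
  obtain ⟨x, -, hx⟩ := h₁ (max N₁ N₂) (le_max_left _ _)
  obtain ⟨y, -, hy⟩ := h₂ (max N₁ N₂) (le_max_right _ _)
  refine ⟨max N₁ N₂ + 1, stepMap l m (max N₁ N₂) fun i => x i - y i, fun i hi => ?_, ?_⟩
  · exact if_neg (by omega)
  · rw [h.levelValue_stepMap, levelValue_sub, hx, hy]

theorem levelValue_eq_zero_iff (h : IsLimitSystem l m g a) (n : ℕ) (x : ℕ → ℤ) :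
    levelValue l g n x = 0 ↔ ∃ k, iterStep l m n k x = fun _ => 0 := by
  refine ⟨fun hx => ⟨1, h.stepMap_eq_zero hx⟩, ?_⟩
  rintro ⟨k, hk⟩
  rw [← h.levelValue_iterStep n x k, hk]
  simp [levelValue]

theorem levelValue_nonneg_iff [IsOrderedAddMonoid G] (h : IsLimitSystem l m g a)
    (ha : Function.Surjective a) (n : ℕ) (x : ℕ → ℤ) :
    0 ≤ levelValue l g n x ↔ ∃ k, ∀ j, 0 ≤ iterStep l m n k x j := by
  refine ⟨fun hx => ?_, ?_⟩
  · obtain ⟨N, hN⟩ := h.exists_nonneg ha hx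
    obtain ⟨y, hy, hyx⟩ := hN (n + N) (Nat.le_add_left N n)
    refine ⟨N + 1, fun j => ?_⟩
    have key := h.stepMap_eq_zero (n := n + N) (x := fun i => iterStep l m n N x i - y i) (by
      rw [levelValue_sub, h.levelValue_iterStep, hyx, sub_self])
    rw [stepMap_sub] at key
    change 0 ≤ stepMap l m (n + N) (iterStep l m n N x) j
    rw [sub_eq_zero.1 (congrFun key j)]
    exact stepMap_nonneg hy j
  · rintro ⟨k, hk⟩
    rw [← h.levelValue_iterStep n x k]
    exact h.levelValue_nonneg hk

end IsLimitSystem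

end System

section Carrier

/-- The dimension group coded by `(f, P, u)`, as a type. -/
def DimGroup {f : ℕ × ℕ → ℕ} {P : ℕ → Bool} {u : ℕ} (_ : IsDimGroupCode f P u) : Type := ℕ

namespace DimGroup

variable {f : ℕ × ℕ → ℕ} {P : ℕ → Bool} {u : ℕ} (h : IsDimGroupCode f P u)

/-- The element of the group with a given code. -/
def mk (a : ℕ) : DimGroup h := a

/-- The code of an element of the group. -/
def code (x : DimGroup h) : ℕ := x

theorem mk_code (x : DimGroup h) : mk h (code h x) = x := rfl

noncomputable instance : AddCommGroup (DimGroup h) :=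
  letI : Add (DimGroup h) := ⟨fun a b => f (a, b)⟩
  letI : Zero (DimGroup h) := ⟨h.1.2.choose⟩
  letI : Neg (DimGroup h) := ⟨fun a => (h.1.2.choose_spec.2 a).choose⟩
  { AddGroup.ofLeftAxioms (G := DimGroup h) h.1.1 (fun a => (h.1.2.choose_spec.1 a).1)
      (fun a => (h.1.2.choose_spec.2 a).choose_spec.2) with
    add_comm := h.2.1 }

theorem mk_add (a b : ℕ) : mk h (f (a, b)) = mk h a + mk h b := rfl

theorem isIdentityOf_zero : IsIdentityOf f (code h 0) := h.1.2.choose_spec.1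

theorem mk_eq_zero {e : ℕ} (he : IsIdentityOf f e) : mk h e = 0 :=
  (isIdentityOf_zero h e).1.symm.trans (he (code h 0)).2

theorem mk_codeSmul {e : ℕ} (he : IsIdentityOf f e) (x n : ℕ) :
    mk h (codeSmul f e x n) = n • mk h x := by
  induction n with
  | zero => rw [zero_smul]; exact mk_eq_zero h he
  | succ n ih => rw [succ_nsmul', ← ih]; rfl

instance : PartialOrder (DimGroup h) where
  le a b := P (code h (b - a)) = true
  le_refl a := by
    rw [sub_self]
    exact (h.2.2.2 _ (isIdentityOf_zero h)).1
  le_trans a b c hab hbc := by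
    rw [← sub_add_sub_cancel c b a]
    exact h.2.2.1 _ _ hbc hab
  le_antisymm a b hab hba := by
    have := (h.2.2.2 _ (isIdentityOf_zero h)).2.1 _ _ hba hab
      (sub_add_sub_cancel a b a |>.trans (sub_self a))
    exact sub_eq_zero.1 this

theorem le_def (a b : DimGroup h) : a ≤ b ↔ P (code h (b - a)) = true := Iff.rfl

theorem nonneg_iff (a : ℕ) : 0 ≤ mk h a ↔ P a = true := by
  rw [le_def, sub_zero]
  rfl

instance : IsOrderedAddMonoid (DimGroup h) where
  add_le_add_left a b hab c := by
    rw [le_def] at *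
    rwa [add_sub_add_right_eq_sub]

theorem codeLe_iff (a b : ℕ) : codeLe f P a b ↔ mk h a ≤ mk h b := by
  constructor
  · rintro ⟨d, hd, hdb⟩
    rw [← hdb, mk_add]
    exact le_add_of_nonneg_right ((nonneg_iff h d).2 hd)
  · intro hab
    exact ⟨code h (mk h b - mk h a), hab, add_sub_cancel (mk h a) (mk h b)⟩

theorem rieszInterpolation : RieszInterpolation (DimGroup h) := by
  intro x₀ x₁ y₀ y₁ h1 h2 h3 h4
  obtain ⟨z, hz⟩ := (h.2.2.2 _ (isIdentityOf_zero h)).2.2.2.2.1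
    (code h x₀) (code h x₁) (code h y₀) (code h y₁)
    ((codeLe_iff h _ _).2 h1) ((codeLe_iff h _ _).2 h2) ((codeLe_iff h _ _).2 h3)
    ((codeLe_iff h _ _).2 h4)
  simp only [codeLe_iff h, mk_code] at hz
  exact ⟨mk h z, hz⟩

theorem unperforated : Unperforated (DimGroup h) := by
  intro a n hn ha
  refine (nonneg_iff h (code h a)).2
    ((h.2.2.2 _ (isIdentityOf_zero h)).2.2.2.1 (code h a) n hn ?_)
  rw [← nonneg_iff h, mk_codeSmul h (isIdentityOf_zero h)]
  exact ha

theorem exists_le_nsmul (x : DimGroup h) : ∃ n : ℕ, x ≤ n • mk h u := by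
  obtain ⟨n, hn, -⟩ := (h.2.2.2 _ (isIdentityOf_zero h)).2.2.2.2.2.2 (code h x)
  refine ⟨n, ?_⟩
  rw [codeLe_iff h, mk_codeSmul h (isIdentityOf_zero h)] at hn
  exact hn

theorem unit_nonneg : 0 ≤ mk h u :=
  (nonneg_iff h u).2 (h.2.2.2 _ (isIdentityOf_zero h)).2.2.2.2.2.1

theorem exists_eq_sub (x : DimGroup h) : ∃ b c : DimGroup h, 0 ≤ b ∧ 0 ≤ c ∧ x = b - c := by
  obtain ⟨a, b, ha, hb, hab⟩ := (h.2.2.2 _ (isIdentityOf_zero h)).2.2.1 (code h x)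
  exact ⟨mk h a, mk h b, (nonneg_iff h a).2 ha, (nonneg_iff h b).2 hb, eq_sub_of_add_eq hab⟩

end DimGroup

/-- `codeSum f e g v k` is the code of `∑ i < k, v i • g i`. -/
def codeSum (f : ℕ × ℕ → ℕ) (e : ℕ) (g v : ℕ → ℕ) : ℕ → ℕ
  | 0 => e
  | k + 1 => f (codeSum f e g v k, codeSmul f e (g k) (v k))

theorem DimGroup.mk_codeSum {f : ℕ × ℕ → ℕ} {P : ℕ → Bool} {u : ℕ} (h : IsDimGroupCode f P u)
    {e : ℕ} (he : IsIdentityOf f e) (g v : ℕ → ℕ) (k : ℕ) :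
    mk h (codeSum f e g v k) = ∑ i ∈ range k, v i • mk h (g i) := by
  induction k with
  | zero => exact mk_eq_zero h he
  | succ k ih => rw [Finset.sum_range_succ, ← ih, ← mk_codeSmul h he]; rfl

end Carrier

section Selection

/-- Measurable selection with values in a countable discrete space. -/
theorem exists_measurable_selection {X T : Type*} [MeasurableSpace X] [MeasurableSpace T]
    [MeasurableSingletonClass T] [Countable T] [Nonempty T] (R : X → T → Prop)
    (hR : ∀ t, MeasurableSet {x | R x t}) :
    ∃ s : X → T, Measurable s ∧ ∀ x, (∃ t, R x t) → R x (s x) := by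
  classical
  obtain ⟨c, hc⟩ := exists_surjective_nat T
  let Q : X → ℕ → Prop := fun x n => R x (c n) ∨ ¬ ∃ t, R x t
  have hex : ∀ x, ∃ n, Q x n := fun x => by
    by_cases hx : ∃ t, R x t
    · obtain ⟨t, ht⟩ := hx
      obtain ⟨n, rfl⟩ := hc t
      exact ⟨n, .inl ht⟩
    · exact ⟨0, .inr hx⟩
  have hQ : ∀ n, MeasurableSet {x | Q x n} := fun n => by
    have h : MeasurableSet {x | ∃ t, R x t} := by
      rw [Set.ofPred_exists]
      exact .iUnion hR
    exact (hR _).union h.compl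
  refine ⟨fun x => c (Nat.find (hex x)), (Measurable.of_discrete).comp (measurable_find hex hQ),
    fun x hx => (Nat.find_spec (hex x)).resolve_right (not_not.2 hx)⟩

theorem measurable_apply_apply {X : Type*} [MeasurableSpace X] {A B : Type*} [Countable A]
    [MeasurableSpace A] [MeasurableSingletonClass A] [MeasurableSpace B] {φ : X → A → B}
    (hφ : ∀ a, Measurable fun x => φ x a) {ψ : X → A} (hψ : Measurable ψ) :
    Measurable fun x => φ x (ψ x) :=
  (measurable_from_prod_countable_right (f := fun p : A × X => φ p.2 p.1) hφ).comp
    (hψ.prodMk measurable_id)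

variable {X : Type*} [MeasurableSpace X] {F : X → ℕ × ℕ → ℕ}

theorem measurable_codeSmul (hF : ∀ p, Measurable fun x => F x p) (e a n : ℕ) :
    Measurable fun x => codeSmul (F x) e a n := by
  induction n with
  | zero => exact measurable_const
  | succ n ih => exact measurable_apply_apply hF (measurable_const.prodMk ih)

theorem measurable_codeSum (hF : ∀ p, Measurable fun x => F x p) (e : ℕ) (g v : ℕ → ℕ) (k : ℕ) :
    Measurable fun x => codeSum (F x) e g v k := by
  induction k with
  | zero => exact measurable_const
  | succ k ih => exact measurable_apply_apply hF (ih.prodMk (measurable_codeSmul hF e _ _))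

/-- A finite stage in the construction of a Bratteli diagram: the number `l` of vertices, their
weights `w`, codes `g` for the group elements attached to them, and the multiplicity matrix `m`
of the edges from the previous stage. -/
@[ext]
structure Stage where
  l : ℕ
  w : ℕ →₀ ℕ
  g : ℕ →₀ ℕ
  m : ℕ × ℕ →₀ ℕ

namespace Stage

instance : Countable Stage :=
  Function.Injective.countable (f := fun S : Stage => (S.l, S.w, S.g, S.m)) fun S T h => by
    simp only [Prod.mk.injEq] at h
    exact Stage.ext h.1 h.2.1 h.2.2.1 h.2.2.2

instance : MeasurableSpace Stage := ⊤

instance : DiscreteMeasurableSpace Stage := ⟨fun _ => trivial⟩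

/-- `T` may follow `S` as stage `n + 1` of the construction for the group coded by `(f, P)`: the
combinatorial conditions hold, the elements of `S` are the prescribed combinations of those of `T`,
all relations among the elements of `S` are killed in `T`, and the element `n`, if positive, is a
positive combination of the elements of `T`. -/
def Extends (f : ℕ × ℕ → ℕ) (P : ℕ → Bool) (n : ℕ) (S T : Stage) : Prop :=
  (∀ j, 0 < T.w j ↔ j < T.l) ∧ (∀ i j, S.l ≤ i ∨ T.l ≤ j → T.m (i, j) = 0) ∧
  (∀ j, j < T.l → T.w j = ∑ i ∈ range S.l, T.m (i, j) * S.w i) ∧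
  (∀ j, j < T.l → P (T.g j) = true) ∧
  ∀ e, IsIdentityOf f e →
    (∀ i, i < S.l → codeSum f e T.g (fun j => T.m (i, j)) T.l = S.g i) ∧
    (∀ v v' : ℕ →₀ ℕ, codeSum f e S.g v S.l = codeSum f e S.g v' S.l →
      ∀ j, j < T.l → ∑ i ∈ range S.l, T.m (i, j) * v i = ∑ i ∈ range S.l, T.m (i, j) * v' i) ∧
    (P n = true → ∃ v : ℕ →₀ ℕ, codeSum f e T.g v T.l = n)

theorem measurable_extends (n : ℕ) (S T : Stage) :
    Measurable fun x : (ℕ × ℕ → ℕ) × (ℕ → Bool) × ℕ => Extends x.1 x.2.1 n S T := by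
  have hf : ∀ p, Measurable fun x : (ℕ × ℕ → ℕ) × (ℕ → Bool) × ℕ => x.1 p := fun p => by fun_prop
  have hP : ∀ j, Measurable fun x : (ℕ × ℕ → ℕ) × (ℕ → Bool) × ℕ => x.2.1 j = true := fun j =>
    (Measurable.of_discrete (f := fun b : Bool => b = true)).comp
      (((measurable_pi_apply j).comp measurable_fst).comp measurable_snd)
  have heq : ∀ a b : (ℕ × ℕ → ℕ) × (ℕ → Bool) × ℕ → ℕ, Measurable a → Measurable b →
      Measurable fun x => a x = b x := fun a b ha hb =>
    (Measurable.of_discrete (f := fun p : ℕ × ℕ => p.1 = p.2)).comp (ha.prodMk hb)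
  have hsum := measurable_codeSum hf
  refine .and measurable_const (.and measurable_const (.and measurable_const (.and
    (.forall fun j => .imp measurable_const (hP _)) (.forall fun e => .imp
      (.forall fun a => .and (heq _ _ (hf _) measurable_const) (heq _ _ (hf _) measurable_const))
      (.and (.forall fun i => .imp measurable_const (heq _ _ (hsum _ _ _ _) measurable_const))
        (.and (.forall fun v => .forall fun v' => .imp (heq _ _ (hsum _ _ _ _) (hsum _ _ _ _))
            measurable_const)
          (.imp (hP _) (.exists fun v => heq _ _ (hsum _ _ _ _) measurable_const))))))))

/-- The invariant of the construction: weights are positive exactly on the vertices, the attached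
elements are positive, and the weighted sum of the latter is the order unit. -/
structure Valid {f : ℕ × ℕ → ℕ} {P : ℕ → Bool} {u : ℕ} (h : IsDimGroupCode f P u)
    (S : Stage) : Prop where
  pos_iff : ∀ i, 0 < S.w i ↔ i < S.l
  nonneg : ∀ i < S.l, 0 ≤ DimGroup.mk h (S.g i)
  sum_eq : ∑ i ∈ range S.l, S.w i • DimGroup.mk h (S.g i) = DimGroup.mk h u

variable {f : ℕ × ℕ → ℕ} {P : ℕ → Bool} {u : ℕ} {h : IsDimGroupCode f P u} {S T : Stage} {n : ℕ}

/-- The finitely supported function agreeing with `v` below `l`. -/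
noncomputable def truncate (l : ℕ) (v : ℕ → ℕ) : ℕ →₀ ℕ :=
  Finsupp.onFinset (range l) (fun i => if i < l then v i else 0) fun i hi => by
    by_contra h
    exact hi (if_neg (by simpa using h))

theorem truncate_apply (l : ℕ) (v : ℕ → ℕ) (i : ℕ) :
    truncate l v i = if i < l then v i else 0 := rfl

theorem Extends.compat (hST : Extends f P n S T) (h : IsDimGroupCode f P u) {i : ℕ}
    (hi : i < S.l) :
    DimGroup.mk h (S.g i) = ∑ j ∈ range T.l, T.m (i, j) • DimGroup.mk h (T.g j) := by
  have he := DimGroup.isIdentityOf_zero h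
  rw [← DimGroup.mk_codeSum h he T.g (fun j => T.m (i, j)), (hST.2.2.2.2 _ he).1 i hi]

theorem Extends.ker (hST : Extends f P n S T) (h : IsDimGroupCode f P u) {v : ℕ → ℤ}
    (hv : ∑ i ∈ range S.l, v i • DimGroup.mk h (S.g i) = 0) {j : ℕ} (hj : j < T.l) :
    ∑ i ∈ range S.l, (T.m (i, j) : ℤ) * v i = 0 := by
  have he := DimGroup.isIdentityOf_zero h
  have hcode : ∀ v : ℕ → ℕ,
      DimGroup.mk h (codeSum f (DimGroup.code h 0) S.g (truncate S.l v) S.l) =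
      ∑ i ∈ range S.l, v i • DimGroup.mk h (S.g i) := fun v =>
    (DimGroup.mk_codeSum h he S.g (truncate S.l v) S.l).trans <| sum_congr rfl fun i hi => by
      rw [truncate_apply, if_pos (mem_range.1 hi)]
  have key := (hST.2.2.2.2 _ he).2.1 (truncate S.l fun i => (v i).toNat)
    (truncate S.l fun i => (-v i).toNat) (by
      change DimGroup.mk h _ = DimGroup.mk h _
      rw [hcode, hcode]
      refine sub_eq_zero.1 (Eq.trans ?_ hv)
      rw [← Finset.sum_sub_distrib]
      refine sum_congr rfl fun i _ => ?_
      rw [← natCast_zsmul, ← natCast_zsmul, ← sub_smul, Int.toNat_sub_toNat_neg]) j hj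
  have hsplit : ∀ i ∈ range S.l, (T.m (i, j) : ℤ) * v i =
      ((T.m (i, j) * truncate S.l (fun i => (v i).toNat) i : ℕ) : ℤ) -
        ((T.m (i, j) * truncate S.l (fun i => (-v i).toNat) i : ℕ) : ℤ) := fun i hi => by
    simp only [truncate_apply, if_pos (mem_range.1 hi), Nat.cast_mul, ← mul_sub,
      Int.toNat_sub_toNat_neg]
  rw [sum_congr rfl hsplit, Finset.sum_sub_distrib, ← Nat.cast_sum, ← Nat.cast_sum, key, sub_self]

theorem Valid.of_extends (hS : Valid h S) (hST : Extends f P n S T) : Valid h T where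
  pos_iff := hST.1
  nonneg j hj := (DimGroup.nonneg_iff h _).2 (hST.2.2.2.1 j hj)
  sum_eq := by
    have hT : ∀ j ∈ range T.l, T.w j • DimGroup.mk h (T.g j) =
        ∑ i ∈ range S.l, S.w i • T.m (i, j) • DimGroup.mk h (T.g j) := fun j hj => by
      rw [hST.2.2.1 j (mem_range.1 hj), Finset.sum_smul]
      exact sum_congr rfl fun i _ => by rw [mul_comm, mul_smul]
    have hS' : ∀ i ∈ range S.l, S.w i • DimGroup.mk h (S.g i) =
        ∑ j ∈ range T.l, S.w i • T.m (i, j) • DimGroup.mk h (T.g j) := fun i hi => by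
      rw [hST.compat h (mem_range.1 hi), Finset.smul_sum]
    rw [← hS.sum_eq, sum_congr rfl hT, sum_congr rfl hS', sum_comm]

theorem Valid.exists_extends (hS : Valid h S) (n : ℕ) : ∃ T, Extends f P n S T := by
  obtain ⟨l, m, q, hq, hpq, hm, hw, hker, hgen⟩ := exists_extension (DimGroup.rieszInterpolation h)
    (DimGroup.unperforated h) (DimGroup.exists_le_nsmul h) hS.nonneg
    (fun i hi => (hS.pos_iff i).2 hi) hS.sum_eq (DimGroup.mk h n)
  let q' : ℕ → ℕ := q
  have hqq : ∀ v : ℕ → ℕ, ∑ j ∈ range l, v j • DimGroup.mk h (truncate l q' j) =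
      ∑ j ∈ range l, v j • q j := fun v => sum_congr rfl fun j hj => by
    rw [truncate_apply, if_pos (mem_range.1 hj)]
    rfl
  refine ⟨⟨l, truncate l fun j => ∑ i ∈ range S.l, m i j * S.w i, truncate l q',
    Finsupp.onFinset (range S.l ×ˢ range l) (fun p => m p.1 p.2) ?_⟩, ?_, hm, ?_, ?_, ?_⟩
  · rintro ⟨i, j⟩ hij
    by_contra hn
    refine hij (hm i j ?_)
    simp only [mem_product, mem_range] at hn
    omega
  · intro j
    simp only [truncate_apply]
    split_ifs with hj
    · exact ⟨fun _ => hj, fun _ => hw j hj⟩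
    · simp [hj]
  · intro j hj
    exact if_pos hj
  · intro j hj
    simp only [truncate_apply, if_pos hj]
    exact (DimGroup.nonneg_iff h _).1 (hq j hj)
  · intro e he
    refine ⟨fun i hi => ?_, fun v v' hv j hj => ?_, fun hn => ?_⟩
    · exact ((DimGroup.mk_codeSum h he _ _ _).trans (hqq _)).trans (hpq i hi).symm
    · have hv' : DimGroup.mk h (codeSum f e S.g v S.l) = DimGroup.mk h (codeSum f e S.g v' S.l) :=
        congrArg _ hv
      rw [DimGroup.mk_codeSum h he, DimGroup.mk_codeSum h he] at hv'
      have := hker (fun i => (v i : ℤ) - v' i) (by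
        simpa [sub_smul, sub_eq_zero] using hv') j hj
      simp only [mul_sub, Finset.sum_sub_distrib, sub_eq_zero] at this
      exact_mod_cast this
    · obtain ⟨v, hv⟩ := hgen ((DimGroup.nonneg_iff h n).2 hn)
      refine ⟨truncate l v, ?_⟩
      refine ((DimGroup.mk_codeSum h he _ _ _).trans (hqq _)).trans (Eq.trans ?_ hv)
      exact sum_congr rfl fun j hj => by rw [truncate_apply, if_pos (mem_range.1 hj)]

/-- The initial stage: one vertex of weight one, to which the order unit is attached. -/
noncomputable def initial (u : ℕ) : Stage := ⟨1, Finsupp.single 0 1, Finsupp.single 0 u, 0⟩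

theorem valid_initial (h : IsDimGroupCode f P u) : Valid h (initial u) where
  pos_iff i := by
    rcases eq_or_ne i 0 with rfl | hi
    · simp [initial]
    · simp [initial, hi]
  nonneg i hi := by
    obtain rfl : i = 0 := Nat.lt_one_iff.1 hi
    simpa [initial] using DimGroup.unit_nonneg h
  sum_eq := by simp [initial]

/-- The stages of the construction can be chosen in a Borel way. -/
theorem exists_measurable_sequence :
    ∃ s : ℕ → ((ℕ × ℕ → ℕ) × (ℕ → Bool) × ℕ) → Stage, (∀ n, Measurable (s n)) ∧
      (∀ x, s 0 x = initial x.2.2) ∧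
      ∀ x, ∀ h : IsDimGroupCode x.1 x.2.1 x.2.2, ∀ n,
        Valid h (s n x) ∧ Extends x.1 x.2.1 n (s n x) (s (n + 1) x) := by
  have : Nonempty Stage := ⟨initial 0⟩
  choose sel hsel hsel' using fun (n : ℕ) (S : Stage) => exists_measurable_selection
    (fun (x : (ℕ × ℕ → ℕ) × (ℕ → Bool) × ℕ) T => Extends x.1 x.2.1 n S T)
    (fun T => measurableSet_setOfPred.2 (measurable_extends n S T))
  let s : ℕ → ((ℕ × ℕ → ℕ) × (ℕ → Bool) × ℕ) → Stage :=
    fun n x => Nat.rec (initial x.2.2) (fun n S => sel n S x) n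
  have hs : ∀ x, ∀ h : IsDimGroupCode x.1 x.2.1 x.2.2, ∀ n, Valid h (s n x) := by
    intro x h n
    induction n with
    | zero => exact valid_initial h
    | succ n ih => exact ih.of_extends (hsel' n (s n x) x (ih.exists_extends n))
  refine ⟨s, fun n => ?_, fun _ => rfl, fun x h n =>
    ⟨hs x h n, hsel' n (s n x) x ((hs x h n).exists_extends n)⟩⟩
  induction n with
  | zero => exact (Measurable.of_discrete (f := initial)).comp (measurable_snd.comp measurable_snd)
  | succ n ih => exact measurable_apply_apply (φ := fun x S => sel n S x) (fun S => hsel n S) ih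

end Stage

end Selection

/-- Borel version of the Effros–Handelman–Shen theorem.  There is a
Borel function assigning to every dimension group `G ∈ 𝒟𝒢` a Bratteli diagram whose
associated dimension group is isomorphic to `G` as an ordered abelian group with order
unit. -/
theorem stmt11 :
    ∃ F : ((ℕ × ℕ → ℕ) × (ℕ → Bool) × ℕ) → (ℕ → ℕ) × (ℕ → ℕ → ℕ) × (ℕ → ℕ × ℕ → ℕ),
      Measurable F ∧
        ∀ x ∈ DGCode, F x ∈ BDCode ∧
          ∃ θ : ℕ → (ℕ → ℤ) → ℕ,
            IsLimitIso (F x).1 (F x).2.1 (F x).2.2 x.1 x.2.1 x.2.2 θ := by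
  obtain ⟨s, hs, hs0, hsx⟩ := Stage.exists_measurable_sequence
  have hmeas : ∀ {B : Type} [MeasurableSpace B] (φ : Stage → B) (n : ℕ),
      Measurable fun x => φ (s n x) := fun φ n => Measurable.of_discrete.comp (hs n)
  refine ⟨fun x => (fun n => (s n x).l, fun n => (s n x).w, fun n => (s (n + 1) x).m), ?_, ?_⟩
  · refine .prodMk (measurable_pi_lambda _ fun n => hmeas _ n) (.prodMk
      (measurable_pi_lambda _ fun n => hmeas (fun S => (S.w : ℕ → ℕ)) n)
      (measurable_pi_lambda _ fun n => hmeas (fun S => (S.m : ℕ × ℕ → ℕ)) (n + 1)))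
  rintro ⟨f, P, u⟩ (h : IsDimGroupCode f P u)
  have hV := fun n => (hsx (f, P, u) h n).1
  have hE := fun n => (hsx (f, P, u) h n).2
  have h0 := hs0 (f, P, u)
  set S : ℕ → Stage := fun n => s n (f, P, u)
  have hsys : IsLimitSystem (fun n => (S n).l) (fun n => (S (n + 1)).m)
      (fun n i => DimGroup.mk h ((S n).g i)) (DimGroup.mk h) :=
    { nonneg := fun n => (hV n).nonneg
      compat := fun n i hi => (hE n).compat h hi
      ker := fun n v hv j hj => (hE n).ker h hv hj
      gen := fun n hn => by
        have he := DimGroup.isIdentityOf_zero h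
        obtain ⟨v, hv⟩ := ((hE n).2.2.2.2 _ he).2.2 ((DimGroup.nonneg_iff h n).1 hn)
        refine ⟨v, Eq.trans ?_ ((DimGroup.mk_codeSum h he _ v _).symm.trans hv)⟩
        simp [levelValue, S] }
  have hsurj : Function.Surjective (DimGroup.mk h) := fun a => ⟨a, rfl⟩
  refine ⟨⟨?_, ?_, fun n => (hV n).pos_iff, fun n => (hE n).2.1, fun n => (hE n).2.2.1⟩,
    fun n x => DimGroup.code h
      (levelValue (fun n => (S n).l) (fun n i => DimGroup.mk h ((S n).g i)) n x),
    fun e he => ⟨fun n x y _ _ => levelValue_add (G := DimGroup h) _ _ n x y,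
      fun n x _ => hsys.levelValue_stepMap n x,
      fun b => hsys.exists_levelValue_eq hsurj (DimGroup.exists_eq_sub h) (DimGroup.mk h b),
      fun n x _ => ?_, fun n x _ => ?_, ?_⟩⟩
  · simp [h0, Stage.initial]
  · simp [h0, Stage.initial]
  · rw [← hsys.levelValue_eq_zero_iff, ← DimGroup.mk_eq_zero h he]
    rfl
  · rw [← hsys.levelValue_nonneg_iff hsurj]
    exact (DimGroup.nonneg_iff h _).symm
  · have hS0 : S 0 = Stage.initial u := h0
    change levelValue _ _ _ _ = DimGroup.mk h u
    simp [levelValue, hS0, h0, unitVec, Stage.initial]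
end
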